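/- arXiv:2505.10739 — 3 statements merged into one kernel-verified Lean document; each statement's English description precedes it below -/
import Mathlib

section
/- Let m, n ≥ 1, let Φ¹ ≤ Γ¹ and Φ² ≤ Γ² be integer m×n prefix-bound matrices and f ≤ g integer m×n matrices, and suppose there exists an integer prefix-bounded matrix A with f ≤ A ≤ g. Then the maximum of the total entry-sum Ã(S_{m,n}) over all such matrices equals min{b*₁(X₁) + b*₂(X₂) + g̃(X₁ᶜ ∩ X₂ᶜ) − f̃(X₁ ∩ X₂) : X₁, X₂ ⊆ S_{m,n}}, and the minimum of the total entry-sum equals max{p*₁(X₁) + p*₂(X₂) + f̃(X₁ᶜ ∩ X₂ᶜ) − g̃(X₁ ∩ X₂) : X₁, X₂ ⊆ S_{m,n}}. -/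
/-- The set of positions of an m×n matrix, 1-based: S_{m,n} = [m] × [n]. -/
def Smn (m n : ℕ) : Finset (ℕ × ℕ) := Finset.Icc 1 m ×ˢ Finset.Icc 1 n

/-- The horizontal prefix P¹_{i,j} = {(i,1), …, (i,j)}. -/
def hPrefix (i j : ℕ) : Finset (ℕ × ℕ) := {i} ×ˢ Finset.Icc 1 j

/-- The vertical prefix P²_{i,j} = {(1,j), …, (i,j)}. -/
def vPrefix (i j : ℕ) : Finset (ℕ × ℕ) := Finset.Icc 1 i ×ˢ {j}

/-- x̃(X), the sum of the entries of x at the positions in X. -/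
def fsum (x : ℕ × ℕ → ℤ) (X : Finset (ℕ × ℕ)) : ℤ := ∑ s ∈ X, x s

/-- A is a prefix-bounded matrix (PBM) of size m×n with respect to the
horizontal-prefix bounds Φ1 ≤ Γ1 and the vertical-prefix bounds Φ2 ≤ Γ2. -/
def IsPBM (m n : ℕ) (Φ1 Γ1 Φ2 Γ2 : ℕ × ℕ → ℤ) (A : ℕ × ℕ → ℤ) : Prop :=
  ∀ i ∈ Finset.Icc 1 m, ∀ j ∈ Finset.Icc 1 n,
    (Φ1 (i, j) ≤ fsum A (hPrefix i j) ∧ fsum A (hPrefix i j) ≤ Γ1 (i, j)) ∧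
    (Φ2 (i, j) ≤ fsum A (vPrefix i j) ∧ fsum A (vPrefix i j) ≤ Γ2 (i, j))

/-- Starting positions of the maximal horizontal segments of X ⊆ S_{m,n}. -/
def hStarts (X : Finset (ℕ × ℕ)) : Finset (ℕ × ℕ) :=
  X.filter (fun s => (s.1, s.2 - 1) ∉ X)

/-- Ending positions of the maximal horizontal segments of X ⊆ S_{m,n}. -/
def hEnds (X : Finset (ℕ × ℕ)) : Finset (ℕ × ℕ) :=
  X.filter (fun s => (s.1, s.2 + 1) ∉ X)

/-- Starting positions of the maximal vertical segments of X ⊆ S_{m,n}. -/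
def vStarts (X : Finset (ℕ × ℕ)) : Finset (ℕ × ℕ) :=
  X.filter (fun s => (s.1 - 1, s.2) ∉ X)

/-- Ending positions of the maximal vertical segments of X ⊆ S_{m,n}. -/
def vEnds (X : Finset (ℕ × ℕ)) : Finset (ℕ × ℕ) :=
  X.filter (fun s => (s.1 + 1, s.2) ∉ X)

/-- σ₁(X): the number of maximal horizontal segments of X. -/
def sigma1 (X : Finset (ℕ × ℕ)) : ℕ := (hStarts X).card

/-- σ₂(X): the number of maximal vertical segments of X. -/
def sigma2 (X : Finset (ℕ × ℕ)) : ℕ := (vStarts X).card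

/-- p*₁(X) = Σ [Φ¹(i,j₂) − Γ¹(i,j₁−1)] over the maximal horizontal segments
{(i,j₁),…,(i,j₂)} of X, with the convention Γ¹(i,0) = 0. -/
def pstar1 (Φ1 Γ1 : ℕ × ℕ → ℤ) (X : Finset (ℕ × ℕ)) : ℤ :=
  ∑ s ∈ hEnds X, Φ1 s -
    ∑ s ∈ hStarts X, (if s.2 = 1 then 0 else Γ1 (s.1, s.2 - 1))

/-- b*₁(X) = Σ [Γ¹(i,j₂) − Φ¹(i,j₁−1)] over the maximal horizontal segments
{(i,j₁),…,(i,j₂)} of X, with the convention Φ¹(i,0) = 0. -/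
def bstar1 (Φ1 Γ1 : ℕ × ℕ → ℤ) (X : Finset (ℕ × ℕ)) : ℤ :=
  ∑ s ∈ hEnds X, Γ1 s -
    ∑ s ∈ hStarts X, (if s.2 = 1 then 0 else Φ1 (s.1, s.2 - 1))

/-- p*₂(X) = Σ [Φ²(i₂,j) − Γ²(i₁−1,j)] over the maximal vertical segments
{(i₁,j),…,(i₂,j)} of X, with the convention Γ²(0,j) = 0. -/
def pstar2 (Φ2 Γ2 : ℕ × ℕ → ℤ) (X : Finset (ℕ × ℕ)) : ℤ :=
  ∑ s ∈ vEnds X, Φ2 s -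
    ∑ s ∈ vStarts X, (if s.1 = 1 then 0 else Γ2 (s.1 - 1, s.2))

/-- b*₂(X) = Σ [Γ²(i₂,j) − Φ²(i₁−1,j)] over the maximal vertical segments
{(i₁,j),…,(i₂,j)} of X, with the convention Φ²(0,j) = 0. -/
def bstar2 (Φ2 Γ2 : ℕ × ℕ → ℤ) (X : Finset (ℕ × ℕ)) : ℤ :=
  ∑ s ∈ vEnds X, Γ2 s -
    ∑ s ∈ vStarts X, (if s.1 = 1 then 0 else Φ2 (s.1 - 1, s.2))

section Augmentation

variable {V E : Type*}

/-- One step of the residual digraph of the flow `x` with bounds `l ≤ x ≤ u` on the arcs in `F`. -/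
def Residual (F : Finset E) (src dst : E → V) (l u x : E → ℤ) (v w : V) : Prop :=
  ∃ e ∈ F, (src e = v ∧ dst e = w ∧ x e < u e) ∨ (dst e = v ∧ src e = w ∧ l e < x e)

/-- The nodes from which `T` can be reached in at most `k` steps of `R`. -/
def reachLayer (R : V → V → Prop) (T : Set V) : ℕ → Set V
  | 0 => T
  | k + 1 => reachLayer R T k ∪ {v | ∃ w ∈ reachLayer R T k, R v w}

/-- A node from which `T` is reachable in the residual digraph admits an integral augmentation
of the flow. The net flow condition is stated by testing against arbitrary potentials. -/
theorem exists_augmentation (F : Finset E) (src dst : E → V) (l u x : E → ℤ) (T : Set V)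
    (hx : ∀ e ∈ F, l e ≤ x e ∧ x e ≤ u e) (k : ℕ) :
    ∀ v ∈ reachLayer (Residual F src dst l u x) T k, ∃ δ : E → ℤ,
      (∀ e ∈ F, l e ≤ x e + δ e ∧ x e + δ e ≤ u e) ∧
      (∀ e, δ e ≠ 0 → src e ∈ reachLayer (Residual F src dst l u x) T k ∧
        dst e ∈ reachLayer (Residual F src dst l u x) T k) ∧
      ∃ t ∈ T, ∀ π : V → ℤ, ∑ e ∈ F, δ e * (π (src e) - π (dst e)) = π v - π t := by
  classical
  induction k with
  | zero =>
    intro v hv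
    exact ⟨0, by simpa using hx, by simp, v, hv, by simp⟩
  | succ k ih =>
    intro v hv
    by_cases hvk : v ∈ reachLayer (Residual F src dst l u x) T k
    · obtain ⟨δ, h1, h2, h3⟩ := ih v hvk
      exact ⟨δ, h1, fun e he => ⟨Or.inl (h2 e he).1, Or.inl (h2 e he).2⟩, h3⟩
    · have hstep : ∃ w ∈ reachLayer (Residual F src dst l u x) T k,
          Residual F src dst l u x v w := hv.resolve_left hvk
      obtain ⟨w, hw, a, ha, hres⟩ := hstep
      obtain ⟨δ, h1, h2, t, ht, h3⟩ := ih w hw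
      have key : ∃ c : ℤ, (l a ≤ x a + c ∧ x a + c ≤ u a) ∧
          ∀ π : V → ℤ, c * (π (src a) - π (dst a)) = π v - π w := by
        have := hx a ha
        rcases hres with ⟨rfl, rfl, h⟩ | ⟨rfl, rfl, h⟩
        · exact ⟨1, by omega, fun π => by ring⟩
        · exact ⟨-1, by omega, fun π => by ring⟩
      have hends : (src a = v ∧ dst a = w) ∨ (dst a = v ∧ src a = w) := by tauto
      have hδa : δ a = 0 := by
        by_contra h
        have := h2 a h
        rcases hends with h | h
        · exact hvk (h.1 ▸ this.1)
        · exact hvk (h.1 ▸ this.2)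
      obtain ⟨c, hc, hπ⟩ := key
      refine ⟨δ + Pi.single a c, ?_, ?_, t, ht, ?_⟩
      · intro e he
        rcases eq_or_ne e a with rfl | hne
        · simpa [hδa] using hc
        · simpa [hne] using h1 e he
      · intro e he
        rcases eq_or_ne e a with rfl | hne
        · rcases hends with h | h
          · exact ⟨h.1 ▸ hv, h.2 ▸ Or.inl hw⟩
          · exact ⟨h.2 ▸ Or.inl hw, h.1 ▸ hv⟩
        · have := h2 e (by simpa [hne] using he)
          exact ⟨Or.inl this.1, Or.inl this.2⟩
      · intro π
        have hs : ∑ e ∈ F, (Pi.single a c : E → ℤ) e * (π (src e) - π (dst e)) = π v - π w := by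
          rw [Finset.sum_eq_single_of_mem a ha]
          · simpa using hπ π
          · intro e _ hne
            simp [hne]
        simp only [Pi.add_apply, add_mul, Finset.sum_add_distrib, h3 π, hs]
        ring

/-- Either the flow can be augmented from a source to a sink, or there is a cut,
with the sources on one side and the sinks on the other, all of whose arcs are tight. -/
theorem exists_augmentation_or_tight_cut (F : Finset E) (src dst : E → V) (l u x : E → ℤ)
    (W T : Set V) (hx : ∀ e ∈ F, l e ≤ x e ∧ x e ≤ u e) :
    (∃ δ : E → ℤ, (∀ e ∈ F, l e ≤ x e + δ e ∧ x e + δ e ≤ u e) ∧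
      ∃ s ∈ W, ∃ t ∈ T, ∀ π : V → ℤ, ∑ e ∈ F, δ e * (π (src e) - π (dst e)) = π s - π t) ∨
    ∃ U : Set V, W ⊆ U ∧ (∀ t ∈ T, t ∉ U) ∧
      (∀ e ∈ F, src e ∈ U → dst e ∉ U → x e = u e) ∧
      (∀ e ∈ F, src e ∉ U → dst e ∈ U → x e = l e) := by
  by_cases h : ∃ s ∈ W, ∃ k, s ∈ reachLayer (Residual F src dst l u x) T k
  · obtain ⟨s, hs, k, hk⟩ := h
    obtain ⟨δ, h1, -, t, ht, h3⟩ := exists_augmentation F src dst l u x T hx k s hk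
    exact Or.inl ⟨δ, h1, s, hs, t, ht, h3⟩
  · refine Or.inr ⟨{v | ¬ ∃ k, v ∈ reachLayer (Residual F src dst l u x) T k},
      fun s hs hk => h ⟨s, hs, hk⟩, fun t ht hU => hU ⟨0, ht⟩, ?_, ?_⟩
    · intro e he hsrc hdst
      simp only [Set.mem_ofPred_eq, not_not] at hsrc hdst
      obtain ⟨k, hk⟩ := hdst
      by_contra hne
      exact hsrc ⟨k + 1, Or.inr ⟨_, hk, e, he, Or.inl ⟨rfl, rfl, lt_of_le_of_ne (hx e he).2 hne⟩⟩⟩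
    · intro e he hsrc hdst
      simp only [Set.mem_ofPred_eq, not_not] at hsrc hdst
      obtain ⟨k, hk⟩ := hsrc
      by_contra hne
      exact hdst ⟨k + 1,
        Or.inr ⟨_, hk, e, he, Or.inr ⟨rfl, rfl, lt_of_le_of_ne (hx e he).1 (Ne.symm hne)⟩⟩⟩

end Augmentation

/-- Telescoping along the maximal `nxt`-chains of a finite set. -/
theorem sum_ends_sub_sum_starts {α : Type*} [DecidableEq α] (X : Finset α) (nxt prv : α → α)
    (hpn : ∀ s, prv (nxt s) = s) (hnp : ∀ s ∈ X, nxt (prv s) = s) (r : α → ℤ) :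
    ∑ s ∈ X with nxt s ∉ X, r s - ∑ s ∈ X with prv s ∉ X, r (prv s) =
      ∑ s ∈ X, (r s - r (prv s)) := by
  have hbij : ∑ s ∈ X with nxt s ∈ X, r s = ∑ s ∈ X with prv s ∈ X, r (prv s) := by
    refine Finset.sum_bij' (fun s _ => nxt s) (fun s _ => prv s) ?_ ?_ ?_ ?_ ?_
    · intro s hs
      simp only [Finset.mem_filter, hpn] at hs ⊢
      exact hs.symm
    · intro s hs
      simp only [Finset.mem_filter] at hs ⊢
      exact ⟨hs.2, (hnp s hs.1).symm ▸ hs.1⟩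
    · intro s _
      exact hpn s
    · intro s hs
      exact hnp s (Finset.mem_filter.1 hs).1
    · intro s _
      rw [hpn]
  rw [Finset.sum_sub_distrib, ← Finset.sum_filter_add_sum_filter_not X (fun s => nxt s ∈ X) r,
    ← Finset.sum_filter_add_sum_filter_not X (fun s => prv s ∈ X) (fun s => r (prv s)), hbij]
  ring

theorem fsum_hPrefix (A : ℕ × ℕ → ℤ) (i j : ℕ) :
    fsum A (hPrefix i j) = ∑ k ∈ Finset.Icc 1 j, A (i, k) := by
  simp [fsum, hPrefix]

theorem fsum_vPrefix (A : ℕ × ℕ → ℤ) (i j : ℕ) :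
    fsum A (vPrefix i j) = ∑ k ∈ Finset.Icc 1 i, A (k, j) := by
  simp [fsum, vPrefix]

theorem bstar1_prefix_sums {m n : ℕ} (A : ℕ × ℕ → ℤ) {X : Finset (ℕ × ℕ)} (hX : X ⊆ Smn m n) :
    bstar1 (fun s => fsum A (hPrefix s.1 s.2)) (fun s => fsum A (hPrefix s.1 s.2)) X =
      fsum A X := by
  have hpos : ∀ s ∈ X, 1 ≤ s.2 := fun s hs => by
    have := hX hs
    simp only [Smn, Finset.mem_product, Finset.mem_Icc] at this
    exact this.2.1
  have h := sum_ends_sub_sum_starts X (fun s => (s.1, s.2 + 1)) (fun s => (s.1, s.2 - 1))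
    (fun s => by simp) (fun s hs => by simp [Nat.sub_add_cancel (hpos s hs)])
    (fun s => fsum A (hPrefix s.1 s.2))
  have hstarts : ∑ s ∈ hStarts X, (if s.2 = 1 then 0 else fsum A (hPrefix s.1 (s.2 - 1))) =
      ∑ s ∈ hStarts X, fsum A (hPrefix s.1 (s.2 - 1)) := by
    refine Finset.sum_congr rfl fun s _ => ?_
    split_ifs with h1
    · simp [fsum_hPrefix, h1]
    · rfl
  simp only [bstar1, hstarts]
  refine h.trans (Finset.sum_congr rfl fun s hs => ?_)
  obtain ⟨i, j⟩ := s
  obtain ⟨k, rfl⟩ := Nat.exists_eq_add_of_le' (hpos _ hs)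
  simp [fsum_hPrefix, Finset.sum_Icc_succ_top]

theorem bstar2_prefix_sums {m n : ℕ} (A : ℕ × ℕ → ℤ) {X : Finset (ℕ × ℕ)} (hX : X ⊆ Smn m n) :
    bstar2 (fun s => fsum A (vPrefix s.1 s.2)) (fun s => fsum A (vPrefix s.1 s.2)) X =
      fsum A X := by
  have hpos : ∀ s ∈ X, 1 ≤ s.1 := fun s hs => by
    have := hX hs
    simp only [Smn, Finset.mem_product, Finset.mem_Icc] at this
    exact this.1.1
  have h := sum_ends_sub_sum_starts X (fun s => (s.1 + 1, s.2)) (fun s => (s.1 - 1, s.2))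
    (fun s => by simp) (fun s hs => by simp [Nat.sub_add_cancel (hpos s hs)])
    (fun s => fsum A (vPrefix s.1 s.2))
  have hstarts : ∑ s ∈ vStarts X, (if s.1 = 1 then 0 else fsum A (vPrefix (s.1 - 1) s.2)) =
      ∑ s ∈ vStarts X, fsum A (vPrefix (s.1 - 1) s.2) := by
    refine Finset.sum_congr rfl fun s _ => ?_
    split_ifs with h1
    · simp [fsum_vPrefix, h1]
    · rfl
  simp only [bstar2, hstarts]
  refine h.trans (Finset.sum_congr rfl fun s hs => ?_)
  obtain ⟨i, j⟩ := s
  obtain ⟨k, rfl⟩ := Nat.exists_eq_add_of_le' (hpos _ hs)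
  simp [fsum_vPrefix, Finset.sum_Icc_succ_top]

theorem bstar1_mono {m n : ℕ} {X : Finset (ℕ × ℕ)} (hX : X ⊆ Smn m n) {Φ Γ Φ' Γ' : ℕ × ℕ → ℤ}
    (hends : ∀ s ∈ hEnds X, Γ s ≤ Γ' s)
    (hstarts : ∀ s ∈ Smn m n, (s.1, s.2 + 1) ∈ X → s ∉ X → Φ' s ≤ Φ s) :
    bstar1 Φ Γ X ≤ bstar1 Φ' Γ' X := by
  refine sub_le_sub (Finset.sum_le_sum hends) (Finset.sum_le_sum fun s hs => ?_)
  split_ifs with h1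
  · rfl
  · obtain ⟨hsX, hs'⟩ := Finset.mem_filter.1 hs
    have hm := hX hsX
    simp only [Smn, Finset.mem_product, Finset.mem_Icc] at hm
    refine hstarts _ ?_ ?_ hs'
    · simp only [Smn, Finset.mem_product, Finset.mem_Icc]
      omega
    · simpa [Nat.sub_add_cancel hm.2.1] using hsX

theorem bstar2_mono {m n : ℕ} {X : Finset (ℕ × ℕ)} (hX : X ⊆ Smn m n) {Φ Γ Φ' Γ' : ℕ × ℕ → ℤ}
    (hends : ∀ s ∈ vEnds X, Γ s ≤ Γ' s)
    (hstarts : ∀ s ∈ Smn m n, (s.1 + 1, s.2) ∈ X → s ∉ X → Φ' s ≤ Φ s) :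
    bstar2 Φ Γ X ≤ bstar2 Φ' Γ' X := by
  refine sub_le_sub (Finset.sum_le_sum hends) (Finset.sum_le_sum fun s hs => ?_)
  split_ifs with h1
  · rfl
  · obtain ⟨hsX, hs'⟩ := Finset.mem_filter.1 hs
    have hm := hX hsX
    simp only [Smn, Finset.mem_product, Finset.mem_Icc] at hm
    refine hstarts _ ?_ ?_ hs'
    · simp only [Smn, Finset.mem_product, Finset.mem_Icc]
      omega
    · simpa [Nat.sub_add_cancel hm.1.1] using hsX

theorem bstar1_neg (Φ Γ : ℕ × ℕ → ℤ) (X : Finset (ℕ × ℕ)) :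
    bstar1 (-Γ) (-Φ) X = -pstar1 Φ Γ X := by
  have h : ∀ s : ℕ × ℕ, (if s.2 = 1 then 0 else (-Γ) (s.1, s.2 - 1)) =
      -(if s.2 = 1 then 0 else Γ (s.1, s.2 - 1)) := fun s => by split_ifs <;> simp
  simp only [bstar1, pstar1, h, Finset.sum_neg_distrib]
  simp only [Pi.neg_apply, Finset.sum_neg_distrib]
  ring

theorem bstar2_neg (Φ Γ : ℕ × ℕ → ℤ) (X : Finset (ℕ × ℕ)) :
    bstar2 (-Γ) (-Φ) X = -pstar2 Φ Γ X := by
  have h : ∀ s : ℕ × ℕ, (if s.1 = 1 then 0 else (-Γ) (s.1 - 1, s.2)) =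
      -(if s.1 = 1 then 0 else Γ (s.1 - 1, s.2)) := fun s => by split_ifs <;> simp
  simp only [bstar2, pstar2, h, Finset.sum_neg_distrib]
  simp only [Pi.neg_apply, Finset.sum_neg_distrib]
  ring

theorem fsum_neg (x : ℕ × ℕ → ℤ) (X : Finset (ℕ × ℕ)) : fsum (-x) X = -fsum x X := by
  simp [fsum]

theorem fsum_add (x y : ℕ × ℕ → ℤ) (X : Finset (ℕ × ℕ)) :
    fsum (x + y) X = fsum x X + fsum y X := by
  simp [fsum, Finset.sum_add_distrib]

theorem fsum_decomposition {S X₁ X₂ : Finset (ℕ × ℕ)} (A : ℕ × ℕ → ℤ) (h₁ : X₁ ⊆ S)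
    (h₂ : X₂ ⊆ S) :
    fsum A S = fsum A X₁ + fsum A X₂ + fsum A ((S \ X₁) ∩ (S \ X₂)) - fsum A (X₁ ∩ X₂) := by
  have hu : (S \ X₁) ∩ (S \ X₂) = S \ (X₁ ∪ X₂) := by
    ext s
    simp only [Finset.mem_inter, Finset.mem_sdiff, Finset.mem_union]
    tauto
  have e1 := Finset.sum_union_inter (s₁ := X₁) (s₂ := X₂) (f := A)
  have e2 := Finset.sum_sdiff (f := A) (Finset.union_subset h₁ h₂)
  simp only [fsum, hu]
  linarith

/-- Weak duality for the maximum total entry-sum. -/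
theorem fsum_le_cut {m n : ℕ} {Φ1 Γ1 Φ2 Γ2 f g A : ℕ × ℕ → ℤ} (hA : IsPBM m n Φ1 Γ1 Φ2 Γ2 A)
    (hfg : ∀ s ∈ Smn m n, f s ≤ A s ∧ A s ≤ g s) {X₁ X₂ : Finset (ℕ × ℕ)}
    (h₁ : X₁ ⊆ Smn m n) (h₂ : X₂ ⊆ Smn m n) :
    fsum A (Smn m n) ≤ bstar1 Φ1 Γ1 X₁ + bstar2 Φ2 Γ2 X₂ +
      fsum g ((Smn m n \ X₁) ∩ (Smn m n \ X₂)) - fsum f (X₁ ∩ X₂) := by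
  have hb : ∀ s ∈ Smn m n, _ := fun s hs =>
    hA s.1 (Finset.mem_product.1 hs).1 s.2 (Finset.mem_product.1 hs).2
  have b1 : fsum A X₁ ≤ bstar1 Φ1 Γ1 X₁ := by
    rw [← bstar1_prefix_sums A h₁]
    exact bstar1_mono h₁ (fun s hs => (hb s (h₁ (Finset.mem_filter.1 hs).1)).1.2)
      (fun s hs _ _ => (hb s hs).1.1)
  have b2 : fsum A X₂ ≤ bstar2 Φ2 Γ2 X₂ := by
    rw [← bstar2_prefix_sums A h₂]
    exact bstar2_mono h₂ (fun s hs => (hb s (h₂ (Finset.mem_filter.1 hs).1)).2.2)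
      (fun s hs _ _ => (hb s hs).2.1)
  have b3 : fsum A ((Smn m n \ X₁) ∩ (Smn m n \ X₂)) ≤ fsum g ((Smn m n \ X₁) ∩ (Smn m n \ X₂)) :=
    Finset.sum_le_sum fun s hs =>
      (hfg s (Finset.mem_sdiff.1 (Finset.mem_inter.1 hs).1).1).2
  have b4 : fsum f (X₁ ∩ X₂) ≤ fsum A (X₁ ∩ X₂) :=
    Finset.sum_le_sum fun s hs => (hfg s (h₁ (Finset.mem_inter.1 hs).1)).1
  rw [fsum_decomposition A h₁ h₂]
  linarith

/-- Either the total entry-sum of a feasible matrix can be increased by one, or it attains the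
bound of `fsum_le_cut`. -/
theorem exists_improvement_or_cut_le {m n : ℕ} {Φ1 Γ1 Φ2 Γ2 f g A : ℕ × ℕ → ℤ}
    (hA : IsPBM m n Φ1 Γ1 Φ2 Γ2 A) (hfg : ∀ s ∈ Smn m n, f s ≤ A s ∧ A s ≤ g s) :
    (∃ B : ℕ × ℕ → ℤ, IsPBM m n Φ1 Γ1 Φ2 Γ2 B ∧ (∀ s ∈ Smn m n, f s ≤ B s ∧ B s ≤ g s) ∧
      fsum B (Smn m n) = fsum A (Smn m n) + 1) ∨
    ∃ X₁ ⊆ Smn m n, ∃ X₂ ⊆ Smn m n, bstar1 Φ1 Γ1 X₁ + bstar2 Φ2 Γ2 X₂ +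
      fsum g ((Smn m n \ X₁) ∩ (Smn m n \ X₂)) - fsum f (X₁ ∩ X₂) ≤ fsum A (Smn m n) := by
  classical
  have hb : ∀ s ∈ Smn m n, _ := fun s hs =>
    hA s.1 (Finset.mem_product.1 hs).1 s.2 (Finset.mem_product.1 hs).2
  have hcut := exists_augmentation_or_tight_cut
    (V := (ℕ × ℕ) ⊕ (ℕ × ℕ)) (E := (ℕ × ℕ) ⊕ ((ℕ × ℕ) ⊕ (ℕ × ℕ)))
    ((Smn m n).disjSum ((Smn m n).disjSum (Smn m n)))
    (Sum.elim Sum.inr (Sum.elim Sum.inl (fun s => Sum.inr (s.1 + 1, s.2))))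
    (Sum.elim Sum.inl (Sum.elim (fun s => Sum.inl (s.1, s.2 + 1)) Sum.inr))
    (Sum.elim f (Sum.elim Φ1 Φ2)) (Sum.elim g (Sum.elim Γ1 Γ2))
    (Sum.elim A (Sum.elim (fun s => fsum A (hPrefix s.1 s.2)) (fun s => fsum A (vPrefix s.1 s.2))))
    {v | ∃ j, v = Sum.inr (m + 1, j)} {v | ∃ i, v = Sum.inl (i, n + 1)}
    (by
      rintro (s | s | s) hs <;> simp only [Finset.inl_mem_disjSum, Finset.inr_mem_disjSum] at hs
      · exact hfg s hs
      · exact (hb s hs).1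
      · exact (hb s hs).2)
  rcases hcut with ⟨δ, hδ, _, ⟨j₀, rfl⟩, _, ⟨i₀, rfl⟩, hπ⟩ | ⟨U, hW, hT, hup, hlow⟩
  · left
    simp only [Finset.sum_disjSum, Sum.elim_inl, Sum.elim_inr] at hπ
    have hrow : ∀ s ∈ Smn m n,
        fsum (fun s => δ (Sum.inl s)) (hPrefix s.1 s.2) = δ (Sum.inr (Sum.inl s)) := by
      rintro ⟨i, j⟩ hs
      simp only [Smn, Finset.mem_product, Finset.mem_Icc] at hs
      have hflow := hπ (Sum.elim (fun s => if s ∈ hPrefix i j then 1 else 0) (fun _ => 0))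
      have hsub : hPrefix i j ⊆ Smn m n := fun s hs' => by
        simp only [Smn, hPrefix, Finset.mem_product, Finset.mem_singleton, Finset.mem_Icc] at hs' ⊢
        omega
      have hend : (i₀, n + 1) ∉ hPrefix i j := by
        simp only [hPrefix, Finset.mem_product, Finset.mem_singleton, Finset.mem_Icc]
        omega
      have hlast : ∀ s ∈ Smn m n, δ (Sum.inr (Sum.inl s)) *
          ((if s ∈ hPrefix i j then 1 else 0) - (if (s.1, s.2 + 1) ∈ hPrefix i j then 1 else 0)) =
          if s = (i, j) then δ (Sum.inr (Sum.inl s)) else 0 := by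
        rintro ⟨a, b⟩ hs'
        simp only [Smn, hPrefix, Finset.mem_product, Finset.mem_singleton, Finset.mem_Icc,
          Prod.mk.injEq] at hs' ⊢
        split_ifs <;> omega
      have hmem : (i, j) ∈ Smn m n := by
        simp only [Smn, Finset.mem_product, Finset.mem_Icc]
        omega
      simp only [Sum.elim_inl, Sum.elim_inr, Finset.sum_congr rfl hlast, Finset.sum_ite_eq', hmem,
        hend, if_true, if_false, zero_sub, sub_self, mul_neg, mul_zero, mul_ite, mul_one,
        Finset.sum_neg_distrib, Finset.sum_const_zero, Finset.sum_ite_mem,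
        Finset.inter_eq_right.2 hsub] at hflow
      simp only [fsum]
      omega
    have hcol : ∀ s ∈ Smn m n,
        fsum (fun s => δ (Sum.inl s)) (vPrefix s.1 s.2) = δ (Sum.inr (Sum.inr s)) := by
      rintro ⟨i, j⟩ hs
      simp only [Smn, Finset.mem_product, Finset.mem_Icc] at hs
      have hflow := hπ (Sum.elim (fun _ => 0) (fun s => if s ∈ vPrefix i j then 1 else 0))
      have hsub : vPrefix i j ⊆ Smn m n := fun s hs' => by
        simp only [Smn, vPrefix, Finset.mem_product, Finset.mem_singleton, Finset.mem_Icc] at hs' ⊢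
        omega
      have hend : (m + 1, j₀) ∉ vPrefix i j := by
        simp only [vPrefix, Finset.mem_product, Finset.mem_singleton, Finset.mem_Icc]
        omega
      have hlast : ∀ s ∈ Smn m n, δ (Sum.inr (Sum.inr s)) *
          ((if (s.1 + 1, s.2) ∈ vPrefix i j then 1 else 0) - (if s ∈ vPrefix i j then 1 else 0)) =
          if s = (i, j) then -δ (Sum.inr (Sum.inr s)) else 0 := by
        rintro ⟨a, b⟩ hs'
        simp only [Smn, vPrefix, Finset.mem_product, Finset.mem_singleton, Finset.mem_Icc,
          Prod.mk.injEq] at hs' ⊢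
        split_ifs <;> omega
      have hmem : (i, j) ∈ Smn m n := by
        simp only [Smn, Finset.mem_product, Finset.mem_Icc]
        omega
      simp only [Sum.elim_inl, Sum.elim_inr, Finset.sum_congr rfl hlast, Finset.sum_ite_eq', hmem,
        hend, if_true, if_false, sub_zero, sub_self, mul_zero, mul_ite, mul_one,
        Finset.sum_const_zero, Finset.sum_ite_mem,
        Finset.inter_eq_right.2 hsub] at hflow
      simp only [fsum]
      omega
    have htot : fsum (fun s => δ (Sum.inl s)) (Smn m n) = 1 := by
      have := hπ (Sum.elim (fun _ => 1) (fun _ => 0))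
      simpa [fsum] using this
    refine ⟨A + fun s => δ (Sum.inl s), ?_, ?_, ?_⟩
    · intro i hi j hj
      have hs : (i, j) ∈ Smn m n := Finset.mem_product.2 ⟨hi, hj⟩
      have h1 := hδ (Sum.inr (Sum.inl (i, j))) (by simpa using hs)
      have h2 := hδ (Sum.inr (Sum.inr (i, j))) (by simpa using hs)
      have e1 := hrow _ hs
      have e2 := hcol _ hs
      simp only [Sum.elim_inl, Sum.elim_inr] at h1 h2 e1 e2
      rw [fsum_add, fsum_add, e1, e2]
      exact ⟨h1, h2⟩
    · intro s hs
      exact hδ (Sum.inl s) (by simpa using hs)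
    · rw [fsum_add, htot]
  · right
    have hup' := fun s hs => hup (Sum.inl s) (Finset.inl_mem_disjSum.2 hs)
    have hlow' := fun s hs => hlow (Sum.inl s) (Finset.inl_mem_disjSum.2 hs)
    have hup1 := fun s hs =>
      hup (Sum.inr (Sum.inl s)) (Finset.inr_mem_disjSum.2 (Finset.inl_mem_disjSum.2 hs))
    have hlow1 := fun s hs =>
      hlow (Sum.inr (Sum.inl s)) (Finset.inr_mem_disjSum.2 (Finset.inl_mem_disjSum.2 hs))
    have hup2 := fun s hs =>
      hup (Sum.inr (Sum.inr s)) (Finset.inr_mem_disjSum.2 (Finset.inr_mem_disjSum.2 hs))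
    have hlow2 := fun s hs =>
      hlow (Sum.inr (Sum.inr s)) (Finset.inr_mem_disjSum.2 (Finset.inr_mem_disjSum.2 hs))
    simp only [Sum.elim_inl, Sum.elim_inr] at hup' hlow' hup1 hlow1 hup2 hlow2
    have h₁ : (Smn m n).filter (fun s => Sum.inl s ∈ U) ⊆ Smn m n := Finset.filter_subset _ _
    have h₂ : (Smn m n).filter (fun s => Sum.inr s ∉ U) ⊆ Smn m n := Finset.filter_subset _ _
    refine ⟨_, h₁, _, h₂, ?_⟩
    have b1 : bstar1 Φ1 Γ1 ((Smn m n).filter (fun s => Sum.inl s ∈ U)) ≤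
        fsum A ((Smn m n).filter (fun s => Sum.inl s ∈ U)) := by
      rw [← bstar1_prefix_sums A h₁]
      refine bstar1_mono h₁ ?_ ?_
      · rintro ⟨i, j⟩ hs
        simp only [hEnds, Finset.mem_filter, not_and] at hs
        refine (hup1 _ hs.1.1 hs.1.2 fun hU => ?_).ge
        by_cases hj : j = n
        · exact hT _ ⟨i, by rw [hj]⟩ hU
        · refine hs.2 ?_ hU
          have := hs.1.1
          simp only [Smn, Finset.mem_product, Finset.mem_Icc] at this ⊢
          omega
      · intro s hs hs1 hs2
        simp only [Finset.mem_filter, not_and] at hs1 hs2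
        exact (hlow1 _ hs (hs2 hs) hs1.2).le
    have b2 : bstar2 Φ2 Γ2 ((Smn m n).filter (fun s => Sum.inr s ∉ U)) ≤
        fsum A ((Smn m n).filter (fun s => Sum.inr s ∉ U)) := by
      rw [← bstar2_prefix_sums A h₂]
      refine bstar2_mono h₂ ?_ ?_
      · rintro ⟨i, j⟩ hs
        simp only [vEnds, Finset.mem_filter, not_and, not_not] at hs
        refine (hup2 _ hs.1.1 ?_ hs.1.2).ge
        by_cases hi : i = m
        · exact hW ⟨j, by rw [hi]⟩
        · refine hs.2 ?_
          have := hs.1.1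
          simp only [Smn, Finset.mem_product, Finset.mem_Icc] at this ⊢
          omega
      · intro s hs hs1 hs2
        simp only [Finset.mem_filter, not_and, not_not] at hs1 hs2
        exact (hlow2 _ hs hs1.2 (hs2 hs)).le
    rw [fsum_decomposition A h₁ h₂]
    refine sub_le_sub (add_le_add (add_le_add b1 b2) (Finset.sum_le_sum ?_)) (Finset.sum_le_sum ?_)
    · intro s hs
      simp only [Finset.mem_inter, Finset.mem_sdiff, Finset.mem_filter, not_and, not_not] at hs
      exact (hup' s hs.1.1 (hs.2.2 hs.1.1) (hs.1.2 hs.1.1)).ge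
    · intro s hs
      simp only [Finset.mem_inter, Finset.mem_filter] at hs
      exact (hlow' s hs.1.1 hs.2.2 hs.1.2).le

theorem max_fsum_eq_min_cut (m n : ℕ) (Φ1 Γ1 Φ2 Γ2 f g : ℕ × ℕ → ℤ)
    (hex : ∃ A : ℕ × ℕ → ℤ, IsPBM m n Φ1 Γ1 Φ2 Γ2 A ∧
      (∀ s ∈ Smn m n, f s ≤ A s ∧ A s ≤ g s)) :
    ∃ M : ℤ,
      IsGreatest {v : ℤ | ∃ A : ℕ × ℕ → ℤ, IsPBM m n Φ1 Γ1 Φ2 Γ2 A ∧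
          (∀ s ∈ Smn m n, f s ≤ A s ∧ A s ≤ g s) ∧ v = fsum A (Smn m n)} M ∧
      IsLeast {v : ℤ | ∃ X₁ ⊆ Smn m n, ∃ X₂ ⊆ Smn m n,
          v = bstar1 Φ1 Γ1 X₁ + bstar2 Φ2 Γ2 X₂ +
            fsum g ((Smn m n \ X₁) ∩ (Smn m n \ X₂)) - fsum f (X₁ ∩ X₂)} M := by
  obtain ⟨A₀, hA₀, hfg₀⟩ := hex
  obtain ⟨M, ⟨A, hA, hfg, rfl⟩, hM⟩ := Int.exists_greatest_of_bdd
    (P := fun v => ∃ A : ℕ × ℕ → ℤ, IsPBM m n Φ1 Γ1 Φ2 Γ2 A ∧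
      (∀ s ∈ Smn m n, f s ≤ A s ∧ A s ≤ g s) ∧ v = fsum A (Smn m n))
    ⟨fsum g (Smn m n), by
      rintro _ ⟨A, -, hfg, rfl⟩
      exact Finset.sum_le_sum fun s hs => (hfg s hs).2⟩
    ⟨_, A₀, hA₀, hfg₀, rfl⟩
  refine ⟨_, ⟨⟨A, hA, hfg, rfl⟩, fun v hv => hM v hv⟩, ?_, ?_⟩
  · rcases exists_improvement_or_cut_le hA hfg with ⟨B, hB, hfgB, hsum⟩ | ⟨X₁, h₁, X₂, h₂, hle⟩
    · have := hM _ ⟨B, hB, hfgB, rfl⟩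
      omega
    · exact ⟨X₁, h₁, X₂, h₂, le_antisymm (fsum_le_cut hA hfg h₁ h₂) hle⟩
  · rintro _ ⟨X₁, h₁, X₂, h₂, rfl⟩
    exact fsum_le_cut hA hfg h₁ h₂

theorem IsPBM.neg {m n : ℕ} {Φ1 Γ1 Φ2 Γ2 A : ℕ × ℕ → ℤ} (hA : IsPBM m n Φ1 Γ1 Φ2 Γ2 A) :
    IsPBM m n (-Γ1) (-Φ1) (-Γ2) (-Φ2) (-A) := by
  intro i hi j hj
  have := hA i hi j hj
  simp only [fsum_neg, Pi.neg_apply]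
  omega

/-- min-max formulae for the total entry-sum of entry-bounded
prefix-bounded matrices (Corollary maxpkm). -/
theorem stmt_10 (m n : ℕ) (hm : 1 ≤ m) (hn : 1 ≤ n)
    (Φ1 Γ1 Φ2 Γ2 f g : ℕ × ℕ → ℤ)
    (hΦΓ1 : ∀ s ∈ Smn m n, Φ1 s ≤ Γ1 s) (hΦΓ2 : ∀ s ∈ Smn m n, Φ2 s ≤ Γ2 s)
    (hfg : ∀ s ∈ Smn m n, f s ≤ g s)
    (hex : ∃ A : ℕ × ℕ → ℤ, IsPBM m n Φ1 Γ1 Φ2 Γ2 A ∧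
      (∀ s ∈ Smn m n, f s ≤ A s ∧ A s ≤ g s)) :
    (∃ M : ℤ,
      IsGreatest {v : ℤ | ∃ A : ℕ × ℕ → ℤ, IsPBM m n Φ1 Γ1 Φ2 Γ2 A ∧
          (∀ s ∈ Smn m n, f s ≤ A s ∧ A s ≤ g s) ∧ v = fsum A (Smn m n)} M ∧
      IsLeast {v : ℤ | ∃ X₁ ⊆ Smn m n, ∃ X₂ ⊆ Smn m n,
          v = bstar1 Φ1 Γ1 X₁ + bstar2 Φ2 Γ2 X₂ +
            fsum g ((Smn m n \ X₁) ∩ (Smn m n \ X₂)) - fsum f (X₁ ∩ X₂)} M) ∧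
    (∃ M : ℤ,
      IsLeast {v : ℤ | ∃ A : ℕ × ℕ → ℤ, IsPBM m n Φ1 Γ1 Φ2 Γ2 A ∧
          (∀ s ∈ Smn m n, f s ≤ A s ∧ A s ≤ g s) ∧ v = fsum A (Smn m n)} M ∧
      IsGreatest {v : ℤ | ∃ X₁ ⊆ Smn m n, ∃ X₂ ⊆ Smn m n,
          v = pstar1 Φ1 Γ1 X₁ + pstar2 Φ2 Γ2 X₂ +
            fsum f ((Smn m n \ X₁) ∩ (Smn m n \ X₂)) - fsum g (X₁ ∩ X₂)} M) := by
  refine ⟨max_fsum_eq_min_cut m n Φ1 Γ1 Φ2 Γ2 f g hex, ?_⟩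
  obtain ⟨A₀, hA₀, hfg₀⟩ := hex
  obtain ⟨M, ⟨⟨A, hA, hAfg, rfl⟩, hmax⟩, ⟨X₁, h₁, X₂, h₂, hX⟩, hmin⟩ :=
    max_fsum_eq_min_cut m n (-Γ1) (-Φ1) (-Γ2) (-Φ2) (-g) (-f)
      ⟨-A₀, hA₀.neg, fun s hs => by
        have := hfg₀ s hs
        simp only [Pi.neg_apply]
        omega⟩
  refine ⟨-fsum A (Smn m n), ⟨⟨-A, ?_, ?_, (fsum_neg _ _).symm⟩, ?_⟩, ⟨X₁, h₁, X₂, h₂, ?_⟩, ?_⟩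
  · simpa only [neg_neg] using hA.neg
  · intro s hs
    have := hAfg s hs
    simp only [Pi.neg_apply] at this ⊢
    omega
  · rintro _ ⟨B, hB, hBfg, rfl⟩
    have := hmax ⟨-B, hB.neg, fun s hs => by
      have := hBfg s hs
      simp only [Pi.neg_apply]
      omega, rfl⟩
    rw [fsum_neg] at this
    omega
  · rw [hX, bstar1_neg, bstar2_neg, fsum_neg, fsum_neg]
    ring
  · rintro _ ⟨Y₁, k₁, Y₂, k₂, rfl⟩
    have := hmin ⟨Y₁, k₁, Y₂, k₂, rfl⟩
    rw [bstar1_neg, bstar2_neg, fsum_neg, fsum_neg] at this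
    omega
end

section
/- Let m, n ≥ 1, let Φ¹ ≤ Γ¹ and Φ² ≤ Γ² be integer m×n prefix-bound matrices, f ≤ g integer m×n matrices, and α ≤ β integers. Let A be an integer prefix-bounded matrix with f ≤ A ≤ g and α ≤ Ã(S_{m,n}) ≤ β, and let k be a positive integer. Then there exist integer m×n matrices A₁, …, A_k with A = A₁ + ⋯ + A_k such that each A_l is a prefix-bounded matrix with respect to the prefix bounds ⌊Φ¹/k⌋, ⌈Γ¹/k⌉, ⌊Φ²/k⌋, ⌈Γ²/k⌉ (entrywise floors and ceilings), satisfies ⌊f/k⌋ ≤ A_l ≤ ⌈g/k⌉ and ⌊α/k⌋ ≤ Ã_l(S_{m,n}) ≤ ⌈β/k⌉, and each A_l is sign-consistent with A: for every position (i,j), if A(i,j) ≥ 0 then A_l(i,j) ≥ 0, and if A(i,j) ≤ 0 then A_l(i,j) ≤ 0. -/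
/-- Entrywise floor of a/k (k a positive natural number). -/
def floorDiv (a : ℤ) (k : ℕ) : ℤ := Int.fdiv a (k : ℤ)

/-- Entrywise ceiling of a/k (k a positive natural number). -/
def ceilDiv (a : ℤ) (k : ℕ) : ℤ := -Int.fdiv (-a) (k : ℤ)

section TwoMatchings

variable {X : Type*}

/-- Two fixed-point-free involutions admit a common sign function that each of them reverses. -/
lemma exists_sign_of_fixedPointFree {s t : X → X} (hs : Function.Involutive s)
    (ht : Function.Involutive t) (hs' : ∀ x, s x ≠ x) (ht' : ∀ x, t x ≠ x) :
    ∃ χ : X → ℤ, (∀ x, χ x = 1 ∨ χ x = -1) ∧ (∀ x, χ (s x) = -χ x) ∧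
      ∀ x, χ (t x) = -χ x := by
  classical
  let σ : Equiv.Perm X := hs.toPerm
  let τ : Equiv.Perm X := ht.toPerm
  let ρ : Equiv.Perm X := σ * τ
  have hσσ : σ * σ = 1 := Equiv.ext hs
  have hττ : τ * τ = 1 := Equiv.ext ht
  have hσi : σ⁻¹ = σ := inv_eq_of_mul_eq_one_left hσσ
  have hτi : τ⁻¹ = τ := inv_eq_of_mul_eq_one_left hττ
  have hρi : ρ⁻¹ = τ * σ := by simp only [ρ, mul_inv_rev, hσi, hτi]
  have hconj : σ * ρ * σ⁻¹ = ρ⁻¹ := by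
    rw [hρi, hσi]
    simp only [ρ, ← mul_assoc, hσσ, one_mul]
  have hzconj (i : ℤ) : σ * ρ ^ i = ρ ^ (-i) * σ := by
    have h := conj_zpow (a := σ) (b := ρ) (i := i)
    rw [hconj, inv_zpow'] at h
    rw [h, inv_mul_cancel_right]
  have hcyc (x : X) : ¬ ρ.SameCycle x (σ x) := by
    rintro ⟨i, hi⟩
    obtain ⟨j, rfl | rfl⟩ := Int.even_or_odd' i
    · apply hs' ((ρ ^ j) x)
      change (σ * ρ ^ j) x = (ρ ^ j) x
      rw [hzconj, Equiv.Perm.mul_apply, ← hi, ← Equiv.Perm.mul_apply, ← zpow_add]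
      congr 2
      ring
    · apply ht' ((ρ ^ j) x)
      apply σ.injective
      change (ρ * ρ ^ j) x = (σ * ρ ^ j) x
      rw [hzconj, Equiv.Perm.mul_apply (ρ ^ (-j)), ← hi, ← Equiv.Perm.mul_apply (ρ ^ (-j)),
        ← zpow_add, ← zpow_one_add]
      congr 2
      ring
  let Q := Quotient (Equiv.Perm.SameCycle.setoid ρ)
  let q : X → Q := Quotient.mk _
  have hne (x : X) : q x ≠ q (σ x) := fun h => hcyc x (Quotient.exact h)
  have hq (x : X) : q (t x) = q (s x) := by
    refine Quotient.sound ⟨1, ?_⟩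
    change s (t (t x)) = s x
    rw [ht]
  have hqs (x : X) : q (s (t x)) = q x := by
    refine Quotient.sound ⟨-1, ?_⟩
    rw [zpow_neg_one, Equiv.Perm.inv_eq_iff_eq]
    rfl
  have hflip (a b : Q) (h : a ≠ b) :
      (if WellOrderingRel a b then (1 : ℤ) else -1) =
        -(if WellOrderingRel b a then (1 : ℤ) else -1) := by
    by_cases h1 : WellOrderingRel a b
    · simp [h1, asymm_of WellOrderingRel h1]
    · by_cases h2 : WellOrderingRel b a
      · simp [h1, h2]
      · exact absurd (Std.Trichotomous.trichotomous (r := WellOrderingRel) a b h1 h2) h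
  refine ⟨fun x => if WellOrderingRel (q x) (q (s x)) then 1 else -1, ?_, ?_, ?_⟩
  · intro x
    dsimp only
    split_ifs <;> simp
  · intro x
    dsimp only
    rw [hs x]
    exact hflip _ _ (hne x).symm
  · intro x
    dsimp only
    rw [hqs, hq]
    exact hflip _ _ (hne x).symm

/-- Two involutions admit a common sign function that each of them reverses off its fixed
points. -/
lemma exists_sign_of_involutive {s t : X → X} (hs : Function.Involutive s)
    (ht : Function.Involutive t) :
    ∃ χ : X → ℤ, (∀ x, χ x = 1 ∨ χ x = -1) ∧ (∀ x, s x ≠ x → χ (s x) = -χ x) ∧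
      ∀ x, t x ≠ x → χ (t x) = -χ x := by
  classical
  let dbl (u : X → X) : X × Bool → X × Bool :=
    fun p => if u p.1 = p.1 then (p.1, !p.2) else (u p.1, p.2)
  have hinv {u : X → X} (hu : Function.Involutive u) : Function.Involutive (dbl u) := by
    rintro ⟨x, b⟩
    by_cases h : u x = x
    · simp [dbl, h]
    · simp [dbl, h, hu x, Ne.symm h]
  have hfree (u : X → X) (p : X × Bool) : dbl u p ≠ p := by
    obtain ⟨x, b⟩ := p
    by_cases h : u x = x <;> simp [dbl, h]
  obtain ⟨χ, h1, h2, h3⟩ :=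
    exists_sign_of_fixedPointFree (hinv hs) (hinv ht) (hfree s) (hfree t)
  refine ⟨fun x => χ (x, true), fun x => h1 _, fun x hx => ?_, fun x hx => ?_⟩
  · simpa [dbl, hx] using h2 (x, true)
  · simpa [dbl, hx] using h3 (x, true)

end TwoMatchings

section Laminar

variable {X : Type*} [DecidableEq X]

/-- The elements of `Y` which the involution `s` does not match inside `Y`. -/
def unmatched (s : X → X) (Y : Finset X) : Finset X :=
  Y.filter fun x => s x ∉ Y ∨ s x = x

/-- A matching can be extended inside `Y` until at most one fixed point remains in `Y`. -/
lemma exists_extend_involutive (Y : Finset X) (s : X → X) (hs : Function.Involutive s) :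
    ∃ t : X → X, Function.Involutive t ∧ (∀ x, s x ≠ x → t x = s x) ∧
      (∀ x, t x ≠ x → s x ≠ x ∨ (x ∈ Y ∧ t x ∈ Y)) ∧
      (Y.filter fun x => t x = x).card ≤ 1 := by
  induction h : (Y.filter fun x => s x = x).card using Nat.strong_induction_on generalizing s with
  | _ N ih =>
    by_cases hN : N ≤ 1
    · exact ⟨s, hs, fun _ _ => rfl, fun x hx => Or.inl hx, h.trans_le hN⟩
    obtain ⟨a, ha, b, hb, hab⟩ := Finset.one_lt_card.1 (h.symm ▸ not_le.1 hN)
    rw [Finset.mem_filter] at ha hb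
    let u : X → X := fun x => if x = a then b else if x = b then a else s x
    have hua : u a = b := by simp [u]
    have hub : u b = a := by simp [u, hab.symm]
    have hux (x : X) (h1 : x ≠ a) (h2 : x ≠ b) : u x = s x := by simp [u, h1, h2]
    have hu : Function.Involutive u := by
      intro x
      by_cases h1 : x = a
      · rw [h1, hua, hub]
      by_cases h2 : x = b
      · rw [h2, hub, hua]
      rw [hux x h1 h2, hux, hs]
      · exact fun h => h1 (by rw [← hs x, h, ha.2])
      · exact fun h => h2 (by rw [← hs x, h, hb.2])
    have hlt : (Y.filter fun x => u x = x).card < N := by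
      rw [← h]
      refine Finset.card_lt_card (Finset.ssubset_iff_of_subset ?_ |>.2 ⟨a, ?_, ?_⟩)
      · intro x hx
        rw [Finset.mem_filter] at hx ⊢
        refine ⟨hx.1, ?_⟩
        rw [← hux x, hx.2]
        · rintro rfl
          exact hab (hx.2.symm.trans hua)
        · rintro rfl
          exact hab (hub.symm.trans hx.2)
      · exact Finset.mem_filter.2 ha
      · rw [Finset.mem_filter, hua]
        exact fun h => hab h.2.symm
    obtain ⟨t, ht, hext, hnew, hcard⟩ := ih _ hlt u hu rfl
    refine ⟨t, ht, fun x hx => ?_, fun x hx => ?_, hcard⟩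
    · have hux' : u x = s x := by
        apply hux <;> rintro rfl
        · exact hx ha.2
        · exact hx hb.2
      rw [hext x (by rwa [hux']), hux']
    · rcases hnew x hx with h1 | h1
      · by_cases hxa : x = a
        · subst hxa
          exact Or.inr ⟨ha.1, by rw [hext _ h1, hua]; exact hb.1⟩
        by_cases hxb : x = b
        · subst hxb
          exact Or.inr ⟨hb.1, by rw [hext _ h1, hub]; exact ha.1⟩
        · exact Or.inl (by rwa [hux x hxa hxb] at h1)
      · exact Or.inr h1

/-- A laminar family admits a matching that leaves at most one element of each member unmatched
within this member. -/
lemma exists_involutive_of_laminar (F : Finset (Finset X))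
    (hF : ∀ Y ∈ F, ∀ Z ∈ F, Y ⊆ Z ∨ Z ⊆ Y ∨ Disjoint Y Z) :
    ∃ s : X → X, Function.Involutive s ∧ (∀ x, s x ≠ x → ∃ Y ∈ F, x ∈ Y ∧ s x ∈ Y) ∧
      ∀ Y ∈ F, (unmatched s Y).card ≤ 1 := by
  induction F using Finset.induction_on_max_value (fun Y : Finset X => Y.card) with
  | empty => exact ⟨id, fun _ => rfl, by simp, by simp⟩
  | insert Y F _ hmax ih =>
    obtain ⟨s, hs, hpair, hone⟩ := ih fun A hA B hB =>
      hF A (Finset.mem_insert_of_mem hA) B (Finset.mem_insert_of_mem hB)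
    obtain ⟨t, ht, hext, hnew, hcard⟩ := exists_extend_involutive Y s hs
    have hmem (x : X) (hx : x ∈ Y) (hsx : s x ≠ x) : s x ∈ Y := by
      obtain ⟨Z, hZ, hxZ, hsZ⟩ := hpair x hsx
      rcases hF Z (Finset.mem_insert_of_mem hZ) Y (Finset.mem_insert_self _ _) with h | h | h
      · exact h hsZ
      · rwa [Finset.eq_of_subset_of_card_le h (hmax Z hZ)]
      · exact absurd hx (Finset.disjoint_left.1 h hxZ)
    refine ⟨t, ht, fun x hx => ?_, fun Z hZ => ?_⟩
    · by_cases hsx : s x = x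
      · have := (hnew x hx).resolve_left (not_not.2 hsx)
        exact ⟨Y, Finset.mem_insert_self _ _, this⟩
      · obtain ⟨Z, hZ, h⟩ := hpair x hsx
        exact ⟨Z, Finset.mem_insert_of_mem hZ, by rwa [hext x hsx]⟩
    · rcases Finset.mem_insert.1 hZ with rfl | hZ
      · refine (Finset.card_le_card fun x hx => ?_).trans hcard
        rw [unmatched, Finset.mem_filter] at hx
        refine Finset.mem_filter.2 ⟨hx.1, ?_⟩
        by_contra htx
        refine hx.2.elim (fun h => h ?_) htx
        by_cases hsx : s x = x
        · exact ((hnew x htx).resolve_left (not_not.2 hsx)).2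
        · rw [hext x hsx]
          exact hmem x hx.1 hsx
      · refine (Finset.card_le_card fun x hx => ?_).trans (hone Z hZ)
        rw [unmatched, Finset.mem_filter] at hx ⊢
        refine ⟨hx.1, ?_⟩
        by_cases hsx : s x = x
        · exact Or.inr hsx
        · rw [← hext x hsx]
          exact hx.2

/-- A sign function reversed by the matching has small sum over a set with at most one unmatched
element. -/
lemma abs_sum_le_one_of_unmatched {s : X → X} (hs : Function.Involutive s) {χ : X → ℤ}
    (h1 : ∀ x, χ x = 1 ∨ χ x = -1) (h2 : ∀ x, s x ≠ x → χ (s x) = -χ x) (Y : Finset X)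
    (hY : (unmatched s Y).card ≤ 1) : |∑ x ∈ Y, χ x| ≤ 1 := by
  have h0 : ∑ x ∈ Y.filter (fun x => ¬ (s x ∉ Y ∨ s x = x)), χ x = 0 := by
    refine Finset.sum_involution (fun x _ => s x) ?_ ?_ ?_ (fun x _ => hs x)
    · intro x hx
      rw [Finset.mem_filter, not_or, not_not] at hx
      rw [h2 x hx.2.2, add_neg_cancel]
    · intro x hx _
      rw [Finset.mem_filter, not_or, not_not] at hx
      exact hx.2.2
    · intro x hx
      rw [Finset.mem_filter, not_or, not_not] at hx ⊢
      exact ⟨hx.2.1, by rw [hs x]; exact hx.1, by rw [hs x]; exact Ne.symm hx.2.2⟩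
  rw [← Finset.sum_filter_add_sum_filter_not Y (fun x => s x ∉ Y ∨ s x = x), h0, add_zero]
  refine (Finset.abs_sum_le_sum_abs _ _).trans ?_
  have habs (x : X) : |χ x| = 1 := by rcases h1 x with h | h <;> simp [h]
  simp only [habs, Finset.sum_const, nsmul_eq_mul, mul_one]
  exact_mod_cast hY

/-- An integer vector splits into two integer vectors which almost agree on every singleton and on
all members of two laminar families. -/
lemma exists_halving (F G : Finset (Finset X))
    (hF : ∀ Y ∈ F, ∀ Z ∈ F, Y ⊆ Z ∨ Z ⊆ Y ∨ Disjoint Y Z)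
    (hG : ∀ Y ∈ G, ∀ Z ∈ G, Y ⊆ Z ∨ Z ⊆ Y ∨ Disjoint Y Z) (C : X → ℤ) :
    ∃ C₁ C₂ : X → ℤ, (∀ x, C₁ x + C₂ x = C x) ∧ (∀ x, |C₁ x - C₂ x| ≤ 1) ∧
      ∀ Y ∈ F ∪ G, |∑ x ∈ Y, C₁ x - ∑ x ∈ Y, C₂ x| ≤ 1 := by
  have hlam (H : Finset (Finset X)) (hH : ∀ Y ∈ H, ∀ Z ∈ H, Y ⊆ Z ∨ Z ⊆ Y ∨ Disjoint Y Z) :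
      ∀ Y ∈ H.image (Finset.filter fun x => Odd (C x)),
        ∀ Z ∈ H.image (Finset.filter fun x => Odd (C x)), Y ⊆ Z ∨ Z ⊆ Y ∨ Disjoint Y Z := by
    simp only [Finset.forall_mem_image]
    intro Y hY Z hZ
    exact (hH Y hY Z hZ).imp (Finset.filter_subset_filter _)
      (Or.imp (Finset.filter_subset_filter _) Finset.disjoint_filter_filter)
  obtain ⟨s, hs, -, hs1⟩ := exists_involutive_of_laminar _ (hlam F hF)
  obtain ⟨t, ht, -, ht1⟩ := exists_involutive_of_laminar _ (hlam G hG)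
  obtain ⟨χ, h1, h2, h3⟩ := exists_sign_of_involutive hs ht
  let D : X → ℤ := fun x => if Odd (C x) then χ x else 0
  have hdvd (x : X) : ∃ c, C x = D x + 2 * c := by
    by_cases h : Odd (C x)
    · obtain ⟨c, hc⟩ := h
      have hD : D x = χ x := if_pos ⟨c, hc⟩
      rcases h1 x with h | h
      · exact ⟨c, by omega⟩
      · exact ⟨c + 1, by omega⟩
    · have hD : D x = 0 := if_neg h
      obtain ⟨c, hc⟩ := Int.not_odd_iff_even.1 h
      exact ⟨c, by omega⟩
  choose E hE using hdvd
  refine ⟨fun x => D x + E x, E, fun x => ?_, fun x => ?_, fun Y hY => ?_⟩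
  · rw [hE x]
    ring
  · rw [add_sub_cancel_right]
    by_cases h : Odd (C x)
    · have hD : D x = χ x := if_pos h
      rcases h1 x with h | h <;> simp [hD, h]
    · have hD : D x = 0 := if_neg h
      simp [hD]
  · rw [Finset.sum_add_distrib, add_sub_cancel_right]
    have hsum : ∑ x ∈ Y, D x = ∑ x ∈ Y.filter (fun x => Odd (C x)), χ x :=
      (Finset.sum_filter _ _).symm
    rw [hsum]
    rcases Finset.mem_union.1 hY with hY | hY
    · exact abs_sum_le_one_of_unmatched hs h1 h2 _ (hs1 _ (Finset.mem_image_of_mem _ hY))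
    · exact abs_sum_le_one_of_unmatched ht h1 h3 _ (ht1 _ (Finset.mem_image_of_mem _ hY))

end Laminar

/-- An integer vector splits into `k` integer vectors which pairwise almost agree on every
prescribed set, as soon as every integer vector splits into two such vectors. -/
lemma exists_balanced_decomposition {X : Type*} (H : Finset (Finset X))
    (hH : ∀ C : X → ℤ, ∃ C₁ C₂ : X → ℤ, (∀ x, C₁ x + C₂ x = C x) ∧
      ∀ Y ∈ H, |∑ x ∈ Y, C₁ x - ∑ x ∈ Y, C₂ x| ≤ 1)
    (A : X → ℤ) (k : ℕ) (hk : 0 < k) :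
    ∃ B : Fin k → X → ℤ, (∀ x, A x = ∑ l, B l x) ∧
      ∀ Y ∈ H, ∀ l l', ∑ x ∈ Y, B l x ≤ ∑ x ∈ Y, B l' x + 1 := by
  let S : Set (Fin k → X → ℤ) := {B | ∀ x, A x = ∑ l, B l x}
  have hS : S.Nonempty := by
    refine ⟨fun l x => if l = ⟨0, hk⟩ then A x else 0, fun x => ?_⟩
    simp
  let w : (Fin k → X → ℤ) → ℕ := fun B => ∑ l, ∑ Y ∈ H, (∑ x ∈ Y, B l x).natAbs ^ 2
  obtain ⟨B, hB, hmin⟩ : ∃ B ∈ S, ∀ B' ∈ S, w B ≤ w B' :=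
    ⟨_, Function.argminOn_mem w S hS, fun B' hB' => Function.argminOn_le w S hB'⟩
  refine ⟨B, hB, fun Y hY l l' => ?_⟩
  by_contra! hlt
  have hne : l ≠ l' := by
    rintro rfl
    omega
  obtain ⟨C₁, C₂, hsum, hbal⟩ := hH fun x => B l x + B l' x
  let B' : Fin k → X → ℤ := Function.update (Function.update B l C₁) l' C₂
  have hl : B' l = C₁ := by simp [B', hne]
  have hl' : B' l' = C₂ := by simp [B']
  have hother (i : Fin k) (h : i ≠ l) (h' : i ≠ l') : B' i = B i := by simp [B', h, h']
  have hsplit {M : Type} [AddCommMonoid M] (φ : Fin k → M) :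
      ∑ i, φ i = φ l + φ l' + ∑ i ∈ (Finset.univ.erase l).erase l', φ i := by
    rw [← Finset.add_sum_erase _ φ (Finset.mem_univ l),
      ← Finset.add_sum_erase _ φ (Finset.mem_erase.2 ⟨hne.symm, Finset.mem_univ l'⟩), add_assoc]
  have hrest (i : Fin k) (hi : i ∈ (Finset.univ.erase l).erase l') : B' i = B i := by
    rw [Finset.mem_erase, Finset.mem_erase] at hi
    exact hother i hi.2.1 hi.1
  have hB' : B' ∈ S := by
    intro x
    rw [hB x, hsplit, hsplit fun i => B' i x, hl, hl', hsum x]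
    congr 1
    exact Finset.sum_congr rfl fun i hi => by rw [hrest i hi]
  refine (hmin B' hB').not_gt ?_
  have hYsum (Z : Finset X) :
      ∑ x ∈ Z, C₁ x + ∑ x ∈ Z, C₂ x = ∑ x ∈ Z, B l x + ∑ x ∈ Z, B l' x := by
    rw [← Finset.sum_add_distrib, ← Finset.sum_add_distrib]
    exact Finset.sum_congr rfl fun x _ => hsum x
  have hsq (a b c d : ℤ) (h : a + b = c + d) (hab : |a - b| ≤ 1) :
      a.natAbs ^ 2 + b.natAbs ^ 2 ≤ c.natAbs ^ 2 + d.natAbs ^ 2 ∧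
        (d + 1 < c → a.natAbs ^ 2 + b.natAbs ^ 2 < c.natAbs ^ 2 + d.natAbs ^ 2) := by
    zify
    simp only [sq_abs]
    rw [abs_le] at hab
    have hid : (c ^ 2 + d ^ 2) * 2 - (a ^ 2 + b ^ 2) * 2 = (c - d) ^ 2 - (a - b) ^ 2 := by
      obtain rfl : a = c + d - b := by omega
      ring
    have h1 : (a - b) ^ 2 ≤ 1 := by nlinarith
    constructor
    · rcases eq_or_ne c d with rfl | hcd
      · have : a = b := by omega
        subst this
        nlinarith
      · have : 1 ≤ (c - d) ^ 2 := by
          have := sq_pos_of_ne_zero (sub_ne_zero.2 hcd)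
          omega
        linarith
    · intro hdc
      have : 2 ≤ c - d := by omega
      nlinarith
  change ∑ i, _ < ∑ i, _
  rw [hsplit, hsplit fun i => ∑ Y ∈ H, (∑ x ∈ Y, B i x).natAbs ^ 2, hl, hl',
    Finset.sum_congr rfl fun i hi =>
      show ∑ Y ∈ H, (∑ x ∈ Y, B' i x).natAbs ^ 2 = ∑ Y ∈ H, (∑ x ∈ Y, B i x).natAbs ^ 2 by
        rw [hrest i hi]]
  refine Nat.add_lt_add_right ?_ _
  rw [← Finset.sum_add_distrib, ← Finset.sum_add_distrib]
  exact Finset.sum_lt_sum (fun Z hZ => (hsq _ _ _ _ (hYsum Z) (hbal Z hZ)).1)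
    ⟨Y, hY, (hsq _ _ _ _ (hYsum Y) (hbal Y hY)).2 hlt⟩

lemma le_of_balanced {k : ℕ} {b : Fin k → ℤ} (hb : ∀ l l', b l ≤ b l' + 1) {q : ℤ}
    (hq : q * k ≤ ∑ l, b l) (l : Fin k) : q ≤ b l := by
  by_contra! h
  have hlt : ∑ i, b i < ∑ _i : Fin k, q :=
    Finset.sum_lt_sum (fun i _ => by have := hb i l; omega) ⟨l, Finset.mem_univ _, h⟩
  rw [Finset.sum_const, Finset.card_univ, Fintype.card_fin, nsmul_eq_mul, mul_comm] at hlt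
  omega

lemma ge_of_balanced {k : ℕ} {b : Fin k → ℤ} (hb : ∀ l l', b l ≤ b l' + 1) {q : ℤ}
    (hq : ∑ l, b l ≤ q * k) (l : Fin k) : b l ≤ q := by
  have := le_of_balanced (b := fun i => -b i) (q := -q)
    (fun i j => by have := hb j i; omega) (by rw [Finset.sum_neg_distrib]; linarith) l
  omega

lemma floorDiv_mul_le (a : ℤ) {k : ℕ} (hk : 0 < k) : floorDiv a k * k ≤ a := by
  rw [floorDiv, Int.fdiv_eq_ediv_of_nonneg _ (Int.natCast_nonneg k)]
  exact Int.ediv_mul_le a (by omega)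

lemma le_ceilDiv_mul (a : ℤ) {k : ℕ} (hk : 0 < k) : a ≤ ceilDiv a k * k := by
  have := floorDiv_mul_le (-a) hk
  rw [floorDiv] at this
  rw [ceilDiv]
  linarith

/-- The horizontal prefixes together with the full index set. -/
def hFamily (m n : ℕ) : Finset (Finset (ℕ × ℕ)) :=
  insert (Smn m n) ((Smn m n).image fun s => hPrefix s.1 s.2)

/-- The vertical prefixes. -/
def vFamily (m n : ℕ) : Finset (Finset (ℕ × ℕ)) :=
  (Smn m n).image fun s => vPrefix s.1 s.2

lemma hPrefix_laminar (i j i' j' : ℕ) : hPrefix i j ⊆ hPrefix i' j' ∨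
    hPrefix i' j' ⊆ hPrefix i j ∨ Disjoint (hPrefix i j) (hPrefix i' j') := by
  by_cases h : i = i'
  · subst h
    rcases le_total j j' with h | h
    · exact Or.inl (Finset.product_subset_product_right (Finset.Icc_subset_Icc_right h))
    · exact Or.inr (Or.inl (Finset.product_subset_product_right (Finset.Icc_subset_Icc_right h)))
  · exact Or.inr (Or.inr (Finset.disjoint_product.2 (Or.inl (Finset.disjoint_singleton.2 h))))

lemma vPrefix_laminar (i j i' j' : ℕ) : vPrefix i j ⊆ vPrefix i' j' ∨
    vPrefix i' j' ⊆ vPrefix i j ∨ Disjoint (vPrefix i j) (vPrefix i' j') := by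
  by_cases h : j = j'
  · subst h
    rcases le_total i i' with h | h
    · exact Or.inl (Finset.product_subset_product_left (Finset.Icc_subset_Icc_right h))
    · exact Or.inr (Or.inl (Finset.product_subset_product_left (Finset.Icc_subset_Icc_right h)))
  · exact Or.inr (Or.inr (Finset.disjoint_product.2 (Or.inr (Finset.disjoint_singleton.2 h))))

lemma hPrefix_subset_Smn {m n : ℕ} {s : ℕ × ℕ} (hs : s ∈ Smn m n) :
    hPrefix s.1 s.2 ⊆ Smn m n := by
  rw [Smn, Finset.mem_product] at hs
  exact Finset.product_subset_product (Finset.singleton_subset_iff.2 hs.1)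
    (Finset.Icc_subset_Icc_right (Finset.mem_Icc.1 hs.2).2)

lemma hFamily_laminar (m n : ℕ) :
    ∀ Y ∈ hFamily m n, ∀ Z ∈ hFamily m n, Y ⊆ Z ∨ Z ⊆ Y ∨ Disjoint Y Z := by
  simp only [hFamily, Finset.forall_mem_insert, Finset.forall_mem_image]
  exact ⟨⟨Or.inl subset_rfl, fun s hs => Or.inr (Or.inl (hPrefix_subset_Smn hs))⟩,
    fun s hs => ⟨Or.inl (hPrefix_subset_Smn hs), fun t _ => hPrefix_laminar _ _ _ _⟩⟩

lemma vFamily_laminar (m n : ℕ) :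
    ∀ Y ∈ vFamily m n, ∀ Z ∈ vFamily m n, Y ⊆ Z ∨ Z ⊆ Y ∨ Disjoint Y Z := by
  simp only [vFamily, Finset.forall_mem_image]
  exact fun s _ t _ => vPrefix_laminar _ _ _ _

/-- sign-consistent integer decomposition of an entry- and
total-sum-bounded prefix-bounded matrix into k prefix-bounded matrices with
the scaled bounds (Corollary int-decomp-spec). -/
theorem stmt_14 (m n : ℕ) (hm : 1 ≤ m) (hn : 1 ≤ n)
    (Φ1 Γ1 Φ2 Γ2 f g : ℕ × ℕ → ℤ) (α β : ℤ)
    (hΦΓ1 : ∀ s ∈ Smn m n, Φ1 s ≤ Γ1 s) (hΦΓ2 : ∀ s ∈ Smn m n, Φ2 s ≤ Γ2 s)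
    (hfg : ∀ s ∈ Smn m n, f s ≤ g s) (hαβ : α ≤ β)
    (A : ℕ × ℕ → ℤ) (hA : IsPBM m n Φ1 Γ1 Φ2 Γ2 A)
    (hAfg : ∀ s ∈ Smn m n, f s ≤ A s ∧ A s ≤ g s)
    (hAαβ : α ≤ fsum A (Smn m n) ∧ fsum A (Smn m n) ≤ β)
    (k : ℕ) (hk : 0 < k) :
    ∃ B : Fin k → (ℕ × ℕ → ℤ),
      (∀ s ∈ Smn m n, A s = ∑ l, B l s) ∧
      (∀ l, IsPBM m n (fun s => floorDiv (Φ1 s) k) (fun s => ceilDiv (Γ1 s) k)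
        (fun s => floorDiv (Φ2 s) k) (fun s => ceilDiv (Γ2 s) k) (B l)) ∧
      (∀ l, ∀ s ∈ Smn m n, floorDiv (f s) k ≤ B l s ∧ B l s ≤ ceilDiv (g s) k) ∧
      (∀ l, floorDiv α k ≤ fsum (B l) (Smn m n) ∧
        fsum (B l) (Smn m n) ≤ ceilDiv β k) ∧
      (∀ l, ∀ s ∈ Smn m n,
        (0 ≤ A s → 0 ≤ B l s) ∧ (A s ≤ 0 → B l s ≤ 0)) := by
  let H := (hFamily m n ∪ vFamily m n) ∪ (Smn m n).image fun s => {s}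
  obtain ⟨B, hsum, hbal⟩ := exists_balanced_decomposition H (fun C => by
    obtain ⟨C₁, C₂, h1, h2, h3⟩ :=
      exists_halving _ _ (hFamily_laminar m n) (vFamily_laminar m n) C
    refine ⟨C₁, C₂, h1, fun Y hY => ?_⟩
    rcases Finset.mem_union.1 hY with hY | hY
    · exact h3 Y hY
    · obtain ⟨s, -, rfl⟩ := Finset.mem_image.1 hY
      simpa using h2 s) A k hk
  have hfsum (Y : Finset (ℕ × ℕ)) : fsum A Y = ∑ l, fsum (B l) Y := by
    simp only [fsum]
    rw [Finset.sum_comm]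
    exact Finset.sum_congr rfl fun x _ => hsum x
  have hlo (Y : Finset (ℕ × ℕ)) (hY : Y ∈ H) (q : ℤ) (hq : q * k ≤ fsum A Y) (l : Fin k) :
      q ≤ fsum (B l) Y :=
    le_of_balanced (b := fun l => fsum (B l) Y) (hbal Y hY) (hq.trans_eq (hfsum Y)) l
  have hhi (Y : Finset (ℕ × ℕ)) (hY : Y ∈ H) (q : ℤ) (hq : fsum A Y ≤ q * k) (l : Fin k) :
      fsum (B l) Y ≤ q :=
    ge_of_balanced (b := fun l => fsum (B l) Y) (hbal Y hY) ((hfsum Y).symm.trans_le hq) l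
  have hbounds (Y : Finset (ℕ × ℕ)) (hY : Y ∈ H) (a b : ℤ) (h : a ≤ fsum A Y ∧ fsum A Y ≤ b)
      (l : Fin k) : floorDiv a k ≤ fsum (B l) Y ∧ fsum (B l) Y ≤ ceilDiv b k :=
    ⟨hlo Y hY _ ((floorDiv_mul_le a hk).trans h.1) l,
      hhi Y hY _ (h.2.trans (le_ceilDiv_mul b hk)) l⟩
  have hsingle (s : ℕ × ℕ) (hs : s ∈ Smn m n) : {s} ∈ H :=
    Finset.mem_union_right _ (Finset.mem_image_of_mem _ hs)
  have hfs (x : ℕ × ℕ → ℤ) (s : ℕ × ℕ) : fsum x {s} = x s := Finset.sum_singleton _ _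
  refine ⟨B, fun s _ => hsum s, fun l i hi j hj => ?_, fun l s hs => ?_, fun l => ?_,
    fun l s hs => ⟨fun h => ?_, fun h => ?_⟩⟩
  · have hs : (i, j) ∈ Smn m n := Finset.mem_product.2 ⟨hi, hj⟩
    refine ⟨hbounds _ ?_ _ _ (hA i hi j hj).1 l, hbounds _ ?_ _ _ (hA i hi j hj).2 l⟩
    · exact Finset.mem_union_left _ (Finset.mem_union_left _ (Finset.mem_insert_of_mem
        (Finset.mem_image_of_mem (fun s : ℕ × ℕ => hPrefix s.1 s.2) hs)))
    · exact Finset.mem_union_left _ (Finset.mem_union_right _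
        (Finset.mem_image_of_mem (fun s : ℕ × ℕ => vPrefix s.1 s.2) hs))
  · have := hbounds {s} (hsingle s hs) (f s) (g s) (by rw [hfs]; exact hAfg s hs) l
    rwa [hfs] at this
  · exact hbounds _ (Finset.mem_union_left _ (Finset.mem_union_left _
      (Finset.mem_insert_self _ _))) _ _ hAαβ l
  · simpa only [hfs] using hlo {s} (hsingle s hs) 0 (by rw [hfs, zero_mul]; exact h) l
  · simpa only [hfs] using hhi {s} (hsingle s hs) 0 (by rw [hfs, zero_mul]; exact h) l
end

section
/- Let n ≥ 1 and let X be an n×n matrix with entries in {0, +1, −1}. Then X has an alternating sign matrix subordinate (i.e., there exists an ASM A of order n with A(s) ∈ {0, X(s)} for every position s) if and only if for all X₁, X₂ ⊆ S_{n,n} satisfying {s : X(s) = +1} ⊆ X₁ ∪ X₂ and {s : X(s) = −1} ∩ X₁ ∩ X₂ = ∅, the inequality σ₁(X₁) + σ₂(X₂) ≥ n holds. -/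
/-- A is an alternating sign matrix (ASM) of order n: every horizontal and
vertical prefix sum lies in {0, 1}, and every full row sum and full column
sum equals 1. -/
def IsASM (n : ℕ) (A : ℕ × ℕ → ℤ) : Prop :=
  (∀ i ∈ Finset.Icc 1 n, ∀ j ∈ Finset.Icc 1 n,
    (fsum A (hPrefix i j) = 0 ∨ fsum A (hPrefix i j) = 1) ∧
    (fsum A (vPrefix i j) = 0 ∨ fsum A (vPrefix i j) = 1)) ∧
  (∀ i ∈ Finset.Icc 1 n, fsum A (hPrefix i n) = 1) ∧
  (∀ j ∈ Finset.Icc 1 n, fsum A (vPrefix n j) = 1)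

open Finset

/-- Summing along the predecessor map `p` over the non-starting points of `X` is the same as
summing over the points of `X` whose successor under `q` stays in `X`. -/
lemma sum_filter_pred_eq {α : Type*} [DecidableEq α] (X : Finset α) (p q : α → α)
    (hpq : ∀ s ∈ X, p (q s) = s) (hqp : ∀ s ∈ X, q (p s) = s) (g : α → ℤ) :
    ∑ s ∈ X with p s ∈ X, g (p s) = ∑ s ∈ X with q s ∈ X, g s := by
  apply Finset.sum_nbij' p q <;> simp_all

/-- The numbers of starting and of ending points of the segments of `X` agree. -/
lemma card_starts_eq_card_ends {α : Type*} [DecidableEq α] (X : Finset α) (p q : α → α)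
    (hpq : ∀ s ∈ X, p (q s) = s) (hqp : ∀ s ∈ X, q (p s) = s) :
    (X.filter (fun s => p s ∉ X)).card = (X.filter (fun s => q s ∉ X)).card := by
  have h := sum_filter_pred_eq X p q hpq hqp (fun _ => 1)
  simp only [sum_const, nsmul_eq_mul, mul_one, Nat.cast_inj] at h
  have h1 := card_filter_add_card_filter_not (s := X) (fun s => p s ∈ X)
  have h2 := card_filter_add_card_filter_not (s := X) (fun s => q s ∈ X)
  omega

/-- If `a` is the increment of a function with values in `[0, 1]`, then the sum of `a` over `X`
is at most the number of segments of `X`. -/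
lemma sum_le_card_starts {α : Type*} [DecidableEq α] (X : Finset α) (p q : α → α)
    (hpq : ∀ s ∈ X, p (q s) = s) (hqp : ∀ s ∈ X, q (p s) = s) (a g : α → ℤ)
    (ha : ∀ s ∈ X, a s = g s - g (p s)) (h1 : ∀ s ∈ X, g s ≤ 1)
    (h0 : ∀ s ∈ X, 0 ≤ g (p s)) :
    ∑ s ∈ X, a s ≤ (X.filter (fun s => p s ∉ X)).card := by
  rw [card_starts_eq_card_ends X p q hpq hqp, sum_congr rfl ha, sum_sub_distrib]
  have e1 := sum_filter_add_sum_filter_not X (fun s => p s ∈ X) (fun s => g (p s))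
  have e2 := sum_filter_add_sum_filter_not X (fun s => q s ∈ X) g
  have e3 := sum_filter_pred_eq X p q hpq hqp g
  have e4 : 0 ≤ ∑ s ∈ X with p s ∉ X, g (p s) :=
    sum_nonneg fun s hs => h0 s (mem_filter.1 hs).1
  have e5 : ∑ s ∈ X with q s ∉ X, g s ≤ ∑ s ∈ X with q s ∉ X, 1 :=
    sum_le_sum fun s hs => h1 s (mem_filter.1 hs).1
  simp only [sum_const, nsmul_eq_mul, mul_one] at e5
  linarith

lemma mem_Smn {m n : ℕ} {s : ℕ × ℕ} :
    s ∈ Smn m n ↔ (1 ≤ s.1 ∧ s.1 ≤ m) ∧ (1 ≤ s.2 ∧ s.2 ≤ n) := by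
  simp [Smn]

lemma fsum_hPrefix_zero (A : ℕ × ℕ → ℤ) (i : ℕ) : fsum A (hPrefix i 0) = 0 := by
  simp [fsum, hPrefix]

lemma fsum_vPrefix_zero (A : ℕ × ℕ → ℤ) (j : ℕ) : fsum A (vPrefix 0 j) = 0 := by
  simp [fsum, vPrefix]

lemma fsum_hPrefix_succ (A : ℕ × ℕ → ℤ) (i j : ℕ) :
    fsum A (hPrefix i (j + 1)) = fsum A (hPrefix i j) + A (i, j + 1) := by
  simp [fsum, hPrefix, sum_Icc_succ_top]

lemma fsum_vPrefix_succ (A : ℕ × ℕ → ℤ) (i j : ℕ) :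
    fsum A (vPrefix (i + 1) j) = fsum A (vPrefix i j) + A (i + 1, j) := by
  simp [fsum, vPrefix, sum_Icc_succ_top]

lemma IsASM.fsum_hPrefix_mem {n : ℕ} {A : ℕ × ℕ → ℤ} (hA : IsASM n A) {i j : ℕ}
    (hi : 1 ≤ i) (hi' : i ≤ n) (hj : j ≤ n) :
    0 ≤ fsum A (hPrefix i j) ∧ fsum A (hPrefix i j) ≤ 1 := by
  rcases Nat.eq_zero_or_pos j with rfl | h
  · simp [fsum_hPrefix_zero]
  · have := (hA.1 i (mem_Icc.2 ⟨hi, hi'⟩) j (mem_Icc.2 ⟨h, hj⟩)).1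
    omega

lemma IsASM.fsum_vPrefix_mem {n : ℕ} {A : ℕ × ℕ → ℤ} (hA : IsASM n A) {i j : ℕ}
    (hj : 1 ≤ j) (hj' : j ≤ n) (hi : i ≤ n) :
    0 ≤ fsum A (vPrefix i j) ∧ fsum A (vPrefix i j) ≤ 1 := by
  rcases Nat.eq_zero_or_pos i with rfl | h
  · simp [fsum_vPrefix_zero]
  · have := (hA.1 i (mem_Icc.2 ⟨h, hi⟩) j (mem_Icc.2 ⟨hj, hj'⟩)).2
    omega

lemma sigma1_eq_card_hEnds {m n : ℕ} {X : Finset (ℕ × ℕ)} (hX : X ⊆ Smn m n) :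
    sigma1 X = (hEnds X).card := by
  refine card_starts_eq_card_ends X (fun s => (s.1, s.2 - 1)) (fun s => (s.1, s.2 + 1))
    (by simp) fun s hs => ?_
  have := mem_Smn.1 (hX hs)
  ext <;> simp
  omega

lemma sigma2_eq_card_vEnds {m n : ℕ} {X : Finset (ℕ × ℕ)} (hX : X ⊆ Smn m n) :
    sigma2 X = (vEnds X).card := by
  refine card_starts_eq_card_ends X (fun s => (s.1 - 1, s.2)) (fun s => (s.1 + 1, s.2))
    (by simp) fun s hs => ?_
  have := mem_Smn.1 (hX hs)
  ext <;> simp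
  omega

lemma IsASM.fsum_le_sigma1 {n : ℕ} {A : ℕ × ℕ → ℤ} (hA : IsASM n A) {X : Finset (ℕ × ℕ)}
    (hX : X ⊆ Smn n n) : fsum A X ≤ sigma1 X := by
  refine sum_le_card_starts X (fun s => (s.1, s.2 - 1)) (fun s => (s.1, s.2 + 1))
    (by simp) (fun s hs => ?_) A (fun s => fsum A (hPrefix s.1 s.2)) (fun s hs => ?_)
    (fun s hs => ?_) (fun s hs => ?_)
  all_goals
    obtain ⟨i, j⟩ := s
    have := mem_Smn.1 (hX hs)
    obtain ⟨j, rfl⟩ : ∃ k, j = k + 1 := ⟨j - 1, by simp at this; omega⟩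
    simp at this ⊢
  · rw [fsum_hPrefix_succ]; ring
  · exact (hA.fsum_hPrefix_mem (by omega) (by omega) (by omega)).2
  · exact (hA.fsum_hPrefix_mem (by omega) (by omega) (by omega)).1

lemma IsASM.fsum_le_sigma2 {n : ℕ} {A : ℕ × ℕ → ℤ} (hA : IsASM n A) {X : Finset (ℕ × ℕ)}
    (hX : X ⊆ Smn n n) : fsum A X ≤ sigma2 X := by
  refine sum_le_card_starts X (fun s => (s.1 - 1, s.2)) (fun s => (s.1 + 1, s.2))
    (by simp) (fun s hs => ?_) A (fun s => fsum A (vPrefix s.1 s.2)) (fun s hs => ?_)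
    (fun s hs => ?_) (fun s hs => ?_)
  all_goals
    obtain ⟨i, j⟩ := s
    have := mem_Smn.1 (hX hs)
    obtain ⟨i, rfl⟩ : ∃ k, i = k + 1 := ⟨i - 1, by simp at this; omega⟩
    simp at this ⊢
  · rw [fsum_vPrefix_succ]; ring
  · exact (hA.fsum_vPrefix_mem (by omega) (by omega) (by omega)).2
  · exact (hA.fsum_vPrefix_mem (by omega) (by omega) (by omega)).1

lemma IsASM.fsum_Smn {n : ℕ} {A : ℕ × ℕ → ℤ} (hA : IsASM n A) : fsum A (Smn n n) = n := by
  have h : fsum A (Smn n n) = ∑ i ∈ Icc 1 n, fsum A (hPrefix i n) := by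
    simp [fsum, Smn, hPrefix, sum_product]
  rw [h, sum_congr rfl hA.2.1]
  simp

/-- A matrix with an ASM subordinate satisfies the segment covering inequality. -/
lemma IsASM.le_sigma_add_sigma {n : ℕ} {A X : ℕ × ℕ → ℤ} (hA : IsASM n A)
    (hX : ∀ s ∈ Smn n n, X s = 0 ∨ X s = 1 ∨ X s = -1)
    (hAX : ∀ s ∈ Smn n n, A s = 0 ∨ A s = X s) {X₁ X₂ : Finset (ℕ × ℕ)}
    (h₁ : X₁ ⊆ Smn n n) (h₂ : X₂ ⊆ Smn n n)
    (hpos : (Smn n n).filter (fun s => X s = 1) ⊆ X₁ ∪ X₂)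
    (hneg : ((Smn n n).filter (fun s => X s = -1)) ∩ X₁ ∩ X₂ = ∅) :
    n ≤ sigma1 X₁ + sigma2 X₂ := by
  have e1 : fsum A X₁ = ∑ s ∈ Smn n n, if s ∈ X₁ then A s else 0 := by
    rw [← sum_filter, filter_mem_eq_inter, inter_eq_right.2 h₁, fsum]
  have e2 : fsum A X₂ = ∑ s ∈ Smn n n, if s ∈ X₂ then A s else 0 := by
    rw [← sum_filter, filter_mem_eq_inter, inter_eq_right.2 h₂, fsum]
  have key : fsum A (Smn n n) ≤ fsum A X₁ + fsum A X₂ := by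
    rw [e1, e2, ← sum_add_distrib]
    refine sum_le_sum fun s hs => ?_
    have hp : X s = 1 → s ∈ X₁ ∪ X₂ := fun h => hpos (mem_filter.2 ⟨hs, h⟩)
    have hm : X s = -1 → s ∈ X₁ → s ∈ X₂ → False := fun h ha hb => by
      have : s ∈ ((Smn n n).filter (fun s => X s = -1)) ∩ X₁ ∩ X₂ := by simp [hs, h, ha, hb]
      simp [hneg] at this
    rw [mem_union] at hp
    have := hX s hs
    have := hAX s hs
    split_ifs <;> grind
  have := hA.fsum_le_sigma1 h₁
  have := hA.fsum_le_sigma2 h₂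
  have := hA.fsum_Smn
  omega

/-- Hall's marriage theorem for a finite set of indices inside a type. -/
lemma exists_injOn_of_hall {α : Type*} [DecidableEq α] (L : Finset α) (t : α → Finset α)
    (h : ∀ T ⊆ L, T.card ≤ (T.biUnion t).card) :
    ∃ f : α → α, Set.InjOn f L ∧ ∀ x ∈ L, f x ∈ t x := by
  obtain ⟨g, hg, hgt⟩ :=
    (all_card_le_biUnion_card_iff_exists_injective (fun x : L => t x)).1 fun s => by
      have := h (s.map (Function.Embedding.subtype _)) (fun x hx => by
        obtain ⟨y, -, rfl⟩ := mem_map.1 hx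
        exact y.2)
      rwa [card_map, map_eq_image, image_biUnion] at this
  refine ⟨fun x => if hx : x ∈ L then g ⟨x, hx⟩ else x, fun x hx y hy hxy => ?_, fun x hx => ?_⟩
  · rw [mem_coe] at hx hy
    simp only [hx, hy, dif_pos] at hxy
    exact congrArg Subtype.val (hg hxy)
  · simpa [hx] using hgt ⟨x, hx⟩

/-- Prefixes which may have a continuation: `inl (i, j)` stands for the horizontal prefix ending
at `(i, j)`, and `inr (i, j)` for the vertical prefix ending at `(i, j)`, where `i < n`. -/
def prefixSources (n : ℕ) : Finset (ℕ × ℕ ⊕ ℕ × ℕ) := (Smn n n).disjSum (Smn (n - 1) n)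

/-- Prefixes which may continue another one: horizontal prefixes ending at `(i, j)` with `j < n`
and all vertical prefixes. -/
def prefixTargets (n : ℕ) : Finset (ℕ × ℕ ⊕ ℕ × ℕ) := (Smn n (n - 1)).disjSum (Smn n n)

/-- The possible continuations of a prefix in the unit capacity network attached to `X`, together
with the loop that represents an unused prefix. -/
def PrefixStep (X : ℕ × ℕ → ℤ) : ℕ × ℕ ⊕ ℕ × ℕ → ℕ × ℕ ⊕ ℕ × ℕ → Prop
  | .inl a, .inl b => b = a ∨ (b.1 = a.1 ∧ b.2 + 1 = a.2)
  | .inl a, .inr b => b = a ∧ X a = 1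
  | .inr a, .inr b => b = a ∨ (b.1 = a.1 + 1 ∧ b.2 = a.2)
  | .inr a, .inl b => b.1 = a.1 + 1 ∧ b.2 + 1 = a.2 ∧ X (a.1 + 1, a.2) = -1

open Classical in
/-- The segment covering inequality gives Hall's condition for the network of prefixes. -/
lemma card_le_card_biUnion_prefixStep {n : ℕ} {X : ℕ × ℕ → ℤ}
    (h : ∀ X₁ ⊆ Smn n n, ∀ X₂ ⊆ Smn n n,
        (Smn n n).filter (fun s => X s = 1) ⊆ X₁ ∪ X₂ →
        ((Smn n n).filter (fun s => X s = -1)) ∩ X₁ ∩ X₂ = ∅ →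
        n ≤ sigma1 X₁ + sigma2 X₂)
    (T : Finset (ℕ × ℕ ⊕ ℕ × ℕ)) (hT : T ⊆ prefixSources n) :
    T.card ≤ (T.biUnion fun x => (prefixTargets n).filter (PrefixStep X x)).card := by
  set N := T.biUnion fun x => (prefixTargets n).filter (PrefixStep X x) with hN
  set X₁ := (Smn n n).filter (fun s => ¬ (Sum.inl s ∈ T ∨
    (2 ≤ s.1 ∧ Sum.inr (s.1 - 1, s.2) ∈ T ∧ X s = -1))) with hX₁
  set X₂ := (Smn n n).filter (fun s => (2 ≤ s.1 ∧ Sum.inr (s.1 - 1, s.2) ∈ T) ∨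
    (Sum.inl s ∈ T ∧ X s = 1)) with hX₂
  have h₁ : X₁ ⊆ Smn n n := filter_subset _ _
  have h₂ : X₂ ⊆ Smn n n := filter_subset _ _
  have hσ : n ≤ sigma1 X₁ + sigma2 X₂ := by
    refine h X₁ h₁ X₂ h₂ (fun s hs => ?_) (eq_empty_of_forall_notMem fun s hs => ?_)
    · grind
    · grind
  rw [sigma1_eq_card_hEnds h₁, sigma2_eq_card_vEnds h₂, ← card_disjSum] at hσ
  have hTl : ∀ i j, Sum.inl (i, j) ∈ T → (1 ≤ i ∧ i ≤ n) ∧ (1 ≤ j ∧ j ≤ n) := fun i j hs => by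
    simpa [prefixSources, mem_Smn] using hT hs
  have hTr : ∀ i j, Sum.inr (i, j) ∈ T → (1 ≤ i ∧ i ≤ n - 1) ∧ (1 ≤ j ∧ j ≤ n) :=
    fun i j hs => by simpa [prefixSources, mem_Smn] using hT hs
  have hdisj : Disjoint T ((hEnds X₁).disjSum (vEnds X₂)) := by
    rw [disjoint_left]
    rintro (⟨i, j⟩ | ⟨i, j⟩) hs hs'
    · rw [inl_mem_disjSum, hEnds, mem_filter, hX₁, mem_filter] at hs'
      exact hs'.1.2 (Or.inl hs)
    · rw [inr_mem_disjSum, vEnds, mem_filter, hX₂, mem_filter, mem_filter] at hs'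
      have := hTr i j hs
      exact hs'.2 ⟨mem_Smn.2 (by simp; omega), Or.inl ⟨by simp; omega, by simpa using hs⟩⟩
  have hsub : T ∪ (hEnds X₁).disjSum (vEnds X₂) ⊆
      N ∪ (Icc 1 n).image (fun i => Sum.inl (i, n)) := by
    have hmem : ∀ x y, x ∈ T → y ∈ prefixTargets n → PrefixStep X x y → y ∈ N :=
      fun x y hx hy hxy => mem_biUnion.2 ⟨x, hx, mem_filter.2 ⟨hy, hxy⟩⟩
    rintro (⟨i, j⟩ | ⟨i, j⟩) hs
    · by_cases hj : j = n
      · subst hj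
        refine mem_union_right _ (mem_image.2 ⟨i, ?_, rfl⟩)
        rw [mem_union, inl_mem_disjSum, hEnds, mem_filter] at hs
        rw [mem_Icc]
        rcases hs with hs | hs
        · exact (hTl _ _ hs).1
        · exact (mem_Smn.1 (h₁ hs.1)).1
      · refine mem_union_left _ ?_
        rw [mem_union, inl_mem_disjSum, hEnds, mem_filter] at hs
        rcases hs with hs | hs
        · have := hTl _ _ hs
          exact hmem _ _ hs (by simp [prefixTargets, mem_Smn]; omega) (Or.inl rfl)
        · have hS := mem_Smn.1 (h₁ hs.1)
          simp only at hS
          have hR : Sum.inl (i, j) ∈ prefixTargets n := by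
            simp [prefixTargets, mem_Smn]; omega
          have h' := hs.2
          rw [hX₁, mem_filter, not_and, not_not] at h'
          rcases h' (mem_Smn.2 (by simp; omega)) with h' | h'
          · exact hmem _ _ h' hR (Or.inr ⟨rfl, rfl⟩)
          · refine hmem _ _ h'.2.1 hR ⟨?_, rfl, ?_⟩
            · have := h'.1; simp at this ⊢; omega
            · have e : i - 1 + 1 = i := by omega
              simpa [e] using h'.2.2
    · refine mem_union_left _ ?_
      rw [mem_union, inr_mem_disjSum, vEnds, mem_filter] at hs
      rcases hs with hs | hs
      · have := hTr _ _ hs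
        exact hmem _ _ hs (by simp [prefixTargets, mem_Smn]; omega) (Or.inl rfl)
      · have hS := mem_Smn.1 (h₂ hs.1)
        simp only at hS
        have hR : Sum.inr (i, j) ∈ prefixTargets n := by
          simp [prefixTargets, mem_Smn]; omega
        rcases (mem_filter.1 hs.1).2 with h' | h'
        · exact hmem _ _ h'.2 hR (Or.inr ⟨by simp; omega, rfl⟩)
        · exact hmem _ _ h'.1 hR ⟨rfl, h'.2⟩
  have hcard := (card_le_card hsub).trans (card_union_le _ _)
  rw [card_union_of_disjoint hdisj] at hcard
  have := card_image_le (s := Icc 1 n) (f := fun i => (Sum.inl (i, n) : ℕ × ℕ ⊕ ℕ × ℕ))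
  rw [Nat.card_Icc] at this
  omega

lemma fsum_hPrefix_eq {n : ℕ} {A H : ℕ × ℕ → ℤ} {i : ℕ} (h0 : H (i, 0) = 0)
    (h : ∀ j, j + 1 ≤ n → A (i, j + 1) = H (i, j + 1) - H (i, j)) (j : ℕ) (hj : j ≤ n) :
    fsum A (hPrefix i j) = H (i, j) := by
  induction j with
  | zero => rw [fsum_hPrefix_zero, h0]
  | succ j ih => rw [fsum_hPrefix_succ, ih (by omega), h j hj]; ring

lemma fsum_vPrefix_eq {n : ℕ} {A V : ℕ × ℕ → ℤ} {j : ℕ} (h0 : V (0, j) = 0)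
    (h : ∀ i, i + 1 ≤ n → A (i + 1, j) = V (i + 1, j) - V (i, j)) (i : ℕ) (hi : i ≤ n) :
    fsum A (vPrefix i j) = V (i, j) := by
  induction i with
  | zero => rw [fsum_vPrefix_zero, h0]
  | succ i ih => rw [fsum_vPrefix_succ, ih (by omega), h i hi]; ring

lemma inl_mem_prefixSources {n i j : ℕ} :
    Sum.inl (i, j) ∈ prefixSources n ↔ (1 ≤ i ∧ i ≤ n) ∧ (1 ≤ j ∧ j ≤ n) := by
  simp [prefixSources, mem_Smn]

lemma inr_mem_prefixSources {n i j : ℕ} :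
    Sum.inr (i, j) ∈ prefixSources n ↔ (1 ≤ i ∧ i ≤ n - 1) ∧ (1 ≤ j ∧ j ≤ n) := by
  simp [prefixSources, mem_Smn]

lemma inl_mem_prefixTargets {n i j : ℕ} :
    Sum.inl (i, j) ∈ prefixTargets n ↔ (1 ≤ i ∧ i ≤ n) ∧ (1 ≤ j ∧ j ≤ n - 1) := by
  simp [prefixTargets, mem_Smn]

lemma inr_mem_prefixTargets {n i j : ℕ} :
    Sum.inr (i, j) ∈ prefixTargets n ↔ (1 ≤ i ∧ i ≤ n) ∧ (1 ≤ j ∧ j ≤ n) := by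
  simp [prefixTargets, mem_Smn]

/-- A matching in the network of prefixes that covers every source. -/
structure IsPrefixMatching (n : ℕ) (X : ℕ × ℕ → ℤ)
    (f : ℕ × ℕ ⊕ ℕ × ℕ → ℕ × ℕ ⊕ ℕ × ℕ) : Prop where
  injOn : Set.InjOn f (prefixSources n)
  mem_targets : ∀ x ∈ prefixSources n, f x ∈ prefixTargets n
  step : ∀ x ∈ prefixSources n, PrefixStep X x (f x)

namespace IsPrefixMatching

variable {n : ℕ} {X : ℕ × ℕ → ℤ} {f : ℕ × ℕ ⊕ ℕ × ℕ → ℕ × ℕ ⊕ ℕ × ℕ}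

lemma exists_preimage (hf : IsPrefixMatching n X f) {y : ℕ × ℕ ⊕ ℕ × ℕ}
    (hy : y ∈ prefixTargets n) : ∃ x ∈ prefixSources n, f x = y := by
  have hc : (prefixTargets n).card ≤ (prefixSources n).card := by
    simp [prefixTargets, prefixSources, Smn]
    grind
  exact surjOn_of_injOn_of_card_le f hf.mem_targets hf.injOn hc hy

lemma step_inl (hf : IsPrefixMatching n X f) {i j : ℕ} (hi : i < n) (hj : j < n) :
    (j + 1 < n ∧ f (.inl (i + 1, j + 1)) = .inl (i + 1, j + 1)) ∨
    (1 ≤ j ∧ f (.inl (i + 1, j + 1)) = .inl (i + 1, j)) ∨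
    (X (i + 1, j + 1) = 1 ∧ f (.inl (i + 1, j + 1)) = .inr (i + 1, j + 1)) := by
  have hx := inl_mem_prefixSources.2 (show (1 ≤ i + 1 ∧ i + 1 ≤ n) ∧ 1 ≤ j + 1 ∧ j + 1 ≤ n by omega)
  have h1 := hf.mem_targets _ hx
  have h2 := hf.step _ hx
  rcases h : f (.inl (i + 1, j + 1)) with ⟨a, b⟩ | ⟨a, b⟩ <;>
    simp only [h, inl_mem_prefixTargets, inr_mem_prefixTargets, PrefixStep] at h1 h2 <;> grind

lemma step_inr (hf : IsPrefixMatching n X f) {i j : ℕ} (hi : i < n) (hj : j < n) (h0 : 1 ≤ i) :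
    f (.inr (i, j + 1)) = .inr (i, j + 1) ∨ f (.inr (i, j + 1)) = .inr (i + 1, j + 1) ∨
    (X (i + 1, j + 1) = -1 ∧ 1 ≤ j ∧ f (.inr (i, j + 1)) = .inl (i + 1, j)) := by
  have hx := inr_mem_prefixSources.2 (show (1 ≤ i ∧ i ≤ n - 1) ∧ 1 ≤ j + 1 ∧ j + 1 ≤ n by omega)
  have h1 := hf.mem_targets _ hx
  have h2 := hf.step _ hx
  rcases h : f (.inr (i, j + 1)) with ⟨a, b⟩ | ⟨a, b⟩ <;>
    simp only [h, inl_mem_prefixTargets, inr_mem_prefixTargets, PrefixStep] at h1 h2 <;> grind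

lemma preimage_inl (hf : IsPrefixMatching n X f) {i j : ℕ} (hi : i < n) (hj : j < n)
    (h0 : 1 ≤ j) :
    f (.inl (i + 1, j)) = .inl (i + 1, j) ∨ f (.inl (i + 1, j + 1)) = .inl (i + 1, j) ∨
    (1 ≤ i ∧ f (.inr (i, j + 1)) = .inl (i + 1, j)) := by
  obtain ⟨⟨a, b⟩ | ⟨a, b⟩, hx, h⟩ :=
      hf.exists_preimage (y := .inl (i + 1, j)) (inl_mem_prefixTargets.2 (by omega)) <;>
    have := hf.step _ hx <;>
    simp only [h, inl_mem_prefixSources, inr_mem_prefixSources, PrefixStep] at this hx <;> grind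

lemma preimage_inr (hf : IsPrefixMatching n X f) {i j : ℕ} (hi : i < n) (hj : j < n) :
    (i + 1 < n ∧ f (.inr (i + 1, j + 1)) = .inr (i + 1, j + 1)) ∨
    f (.inl (i + 1, j + 1)) = .inr (i + 1, j + 1) ∨
    (1 ≤ i ∧ f (.inr (i, j + 1)) = .inr (i + 1, j + 1)) := by
  obtain ⟨⟨a, b⟩ | ⟨a, b⟩, hx, h⟩ :=
      hf.exists_preimage (y := .inr (i + 1, j + 1)) (inr_mem_prefixTargets.2 (by omega)) <;>
    have := hf.step _ hx <;>
    simp only [h, inl_mem_prefixSources, inr_mem_prefixSources, PrefixStep] at this hx <;> grind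

lemma inl_ne_inl (hf : IsPrefixMatching n X f) {i j : ℕ} (hi : i < n) (hj : j < n)
    (h0 : 1 ≤ j) : f (.inl (i + 1, j)) ≠ f (.inl (i + 1, j + 1)) := by
  intro h
  have := hf.injOn (inl_mem_prefixSources.2 (by omega)) (inl_mem_prefixSources.2 (by omega)) h
  simp at this

lemma inr_ne_inr (hf : IsPrefixMatching n X f) {i j : ℕ} (hi : i + 1 < n) (hj : j < n)
    (h0 : 1 ≤ i) : f (.inr (i, j + 1)) ≠ f (.inr (i + 1, j + 1)) := by
  intro h
  have := hf.injOn (inr_mem_prefixSources.2 (by omega)) (inr_mem_prefixSources.2 (by omega)) h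
  simp at this

lemma inl_ne_inr (hf : IsPrefixMatching n X f) {i j k l : ℕ} (hi : 1 ≤ i) (hi' : i ≤ n)
    (hj : 1 ≤ j) (hj' : j ≤ n) (hk : 1 ≤ k) (hk' : k < n) (hl : 1 ≤ l) (hl' : l ≤ n) :
    f (.inl (i, j)) ≠ f (.inr (k, l)) := by
  intro h
  have := hf.injOn (inl_mem_prefixSources.2 (by omega)) (inr_mem_prefixSources.2 (by omega)) h
  simp at this

end IsPrefixMatching

/-- The matrix read off from a matching in the network of prefixes. -/
def matchingMatrix (f : ℕ × ℕ ⊕ ℕ × ℕ → ℕ × ℕ ⊕ ℕ × ℕ) (s : ℕ × ℕ) : ℤ :=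
  if f (.inl s) = .inr s then 1 else
  if 2 ≤ s.1 ∧ 2 ≤ s.2 ∧ f (.inr (s.1 - 1, s.2)) = .inl (s.1, s.2 - 1) then -1 else 0

/-- The horizontal prefix sums of `matchingMatrix f`. -/
def matchingHSum (n : ℕ) (f : ℕ × ℕ ⊕ ℕ × ℕ → ℕ × ℕ ⊕ ℕ × ℕ) (s : ℕ × ℕ) : ℤ :=
  if s.2 = 0 then 0 else if s.2 < n ∧ f (.inl s) = .inl s then 0 else 1

/-- The vertical prefix sums of `matchingMatrix f`. -/
def matchingVSum (n : ℕ) (f : ℕ × ℕ ⊕ ℕ × ℕ → ℕ × ℕ ⊕ ℕ × ℕ) (s : ℕ × ℕ) : ℤ :=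
  if s.1 = 0 then 0 else if s.1 < n ∧ f (.inr s) = .inr s then 0 else 1

namespace IsPrefixMatching

variable {n : ℕ} {X : ℕ × ℕ → ℤ} {f : ℕ × ℕ ⊕ ℕ × ℕ → ℕ × ℕ ⊕ ℕ × ℕ}

lemma matchingMatrix_eq_hSum_sub (hf : IsPrefixMatching n X f) {i j : ℕ} (hi : i < n)
    (hj : j < n) : matchingMatrix f (i + 1, j + 1) =
      matchingHSum n f (i + 1, j + 1) - matchingHSum n f (i + 1, j) := by
  have a1 := hf.step_inl hi hj
  have a2 := fun h => hf.step_inr hi hj h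
  have a3 := fun h => hf.preimage_inl hi hj h
  have b1 := fun h => hf.inl_ne_inl hi hj h
  have b2 : 1 ≤ i → f (.inl (i + 1, j + 1)) ≠ f (.inr (i, j + 1)) := fun h =>
    hf.inl_ne_inr (by omega) (by omega) (by omega) (by omega) h hi (by omega) (by omega)
  have b3 : 1 ≤ i → 1 ≤ j → f (.inl (i + 1, j)) ≠ f (.inr (i, j + 1)) := fun h h' =>
    hf.inl_ne_inr (by omega) (by omega) h' (by omega) h hi (by omega) (by omega)
  simp only [matchingMatrix, matchingHSum, Nat.add_sub_cancel]
  grind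

lemma matchingMatrix_eq_vSum_sub (hf : IsPrefixMatching n X f) {i j : ℕ} (hi : i < n)
    (hj : j < n) : matchingMatrix f (i + 1, j + 1) =
      matchingVSum n f (i + 1, j + 1) - matchingVSum n f (i, j + 1) := by
  have a1 := hf.step_inl hi hj
  have a2 := fun h => hf.step_inr hi hj h
  have a3 := hf.preimage_inr hi hj
  have b1 := fun h h' => hf.inr_ne_inr (i := i) h hj h'
  have b2 : 1 ≤ i → f (.inl (i + 1, j + 1)) ≠ f (.inr (i, j + 1)) := fun h =>
    hf.inl_ne_inr (by omega) (by omega) (by omega) (by omega) h hi (by omega) (by omega)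
  have b3 : i + 1 < n → f (.inl (i + 1, j + 1)) ≠ f (.inr (i + 1, j + 1)) := fun h =>
    hf.inl_ne_inr (by omega) (by omega) (by omega) (by omega) (by omega) h (by omega) (by omega)
  simp only [matchingMatrix, matchingVSum, Nat.add_sub_cancel]
  grind

lemma matchingMatrix_eq_zero_or (hf : IsPrefixMatching n X f) {s : ℕ × ℕ}
    (hs : s ∈ Smn n n) : matchingMatrix f s = 0 ∨ matchingMatrix f s = X s := by
  obtain ⟨i, j⟩ := s
  have hs' := mem_Smn.1 hs
  obtain ⟨i, rfl⟩ : ∃ k, i = k + 1 := ⟨i - 1, by simp at hs'; omega⟩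
  obtain ⟨j, rfl⟩ : ∃ k, j = k + 1 := ⟨j - 1, by simp at hs'; omega⟩
  simp only at hs'
  have a1 := hf.step_inl (i := i) (j := j) (by omega) (by omega)
  have a2 := hf.step_inr (i := i) (j := j) (by omega) (by omega)
  simp only [matchingMatrix, Nat.add_sub_cancel]
  grind

/-- A perfect matching in the network of prefixes yields an ASM. -/
lemma isASM_matchingMatrix (hf : IsPrefixMatching n X f) : IsASM n (matchingMatrix f) := by
  have hrow : ∀ i, 1 ≤ i → i ≤ n → ∀ j ≤ n,
      fsum (matchingMatrix f) (hPrefix i j) = matchingHSum n f (i, j) := by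
    intro i hi hi'
    obtain ⟨i, rfl⟩ : ∃ k, i = k + 1 := ⟨i - 1, by omega⟩
    exact fsum_hPrefix_eq (by simp [matchingHSum]) fun j hj =>
      hf.matchingMatrix_eq_hSum_sub (by omega) (by omega)
  have hcol : ∀ j, 1 ≤ j → j ≤ n → ∀ i ≤ n,
      fsum (matchingMatrix f) (vPrefix i j) = matchingVSum n f (i, j) := by
    intro j hj hj'
    obtain ⟨j, rfl⟩ : ∃ k, j = k + 1 := ⟨j - 1, by omega⟩
    exact fsum_vPrefix_eq (by simp [matchingVSum]) fun i hi =>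
      hf.matchingMatrix_eq_vSum_sub (by omega) (by omega)
  refine ⟨fun i hi j hj => ?_, fun i hi => ?_, fun j hj => ?_⟩
  · rw [mem_Icc] at hi hj
    rw [hrow i hi.1 hi.2 j hj.2, hcol j hj.1 hj.2 i hi.2, matchingHSum, matchingVSum]
    grind
  · rw [mem_Icc] at hi
    rw [hrow i hi.1 hi.2 n le_rfl, matchingHSum]
    grind
  · rw [mem_Icc] at hj
    rw [hcol j hj.1 hj.2 n le_rfl, matchingVSum]
    grind

end IsPrefixMatching

/-- a (0,±1)-matrix X has an alternating sign matrix subordinate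
iff the +1 entries of X cannot be covered by fewer than n separated segments
covering each −1 entry at most once (Theorem alarendelt). -/
theorem stmt_18 (n : ℕ) (hn : 1 ≤ n) (X : ℕ × ℕ → ℤ)
    (hX : ∀ s ∈ Smn n n, X s = 0 ∨ X s = 1 ∨ X s = -1) :
    (∃ A : ℕ × ℕ → ℤ, IsASM n A ∧
        ∀ s ∈ Smn n n, A s = 0 ∨ A s = X s) ↔
      (∀ X₁ ⊆ Smn n n, ∀ X₂ ⊆ Smn n n,
        (Smn n n).filter (fun s => X s = 1) ⊆ X₁ ∪ X₂ →
        ((Smn n n).filter (fun s => X s = -1)) ∩ X₁ ∩ X₂ = ∅ →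
        n ≤ sigma1 X₁ + sigma2 X₂) := by
  classical
  constructor
  · rintro ⟨A, hA, hAX⟩ X₁ h₁ X₂ h₂ hpos hneg
    exact hA.le_sigma_add_sigma hX hAX h₁ h₂ hpos hneg
  · intro h
    obtain ⟨f, hinj, hf⟩ := exists_injOn_of_hall (prefixSources n)
      (fun x => (prefixTargets n).filter (PrefixStep X x)) (card_le_card_biUnion_prefixStep h)
    have hm : IsPrefixMatching n X f := ⟨hinj, fun x hx => (mem_filter.1 (hf x hx)).1,
      fun x hx => (mem_filter.1 (hf x hx)).2⟩
    exact ⟨matchingMatrix f, hm.isASM_matchingMatrix, fun s hs => hm.matchingMatrix_eq_zero_or hs⟩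
end
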